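/- arXiv:1101.3352 — 2 statements merged into one kernel-verified Lean document; each statement's English description precedes it below -/
import Mathlib

section
/- If X₁ and X₂ are independent random vectors uniformly distributed on convex bodies A₁ and A₂ in ℝⁿ respectively, then h(X₁ + X₂) ≥ log |A₁ + A₂| − n log 2, where A₁ + A₂ is the Minkowski sum and |·| denotes Lebesgue volume. -/
open MeasureTheory ProbabilityTheory Real Pointwise

/-- Differential (Shannon) entropy of a measure on ℝⁿ,
computed from its density w.r.t. Lebesgue measure: `h(μ) = -∫ p log p`. -/
noncomputable def dEnt {n : ℕ} (μ : Measure (EuclideanSpace ℝ (Fin n))) : ℝ :=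
  -∫ x, ((μ.rnDeriv volume x).toReal) * Real.log ((μ.rnDeriv volume x).toReal)


theorem bm_one_compact {A B : Set ℝ} (hA : IsCompact A) (hB : IsCompact B)
    (hAn : A.Nonempty) (hBn : B.Nonempty) : volume A + volume B ≤ volume (A + B) := by
  obtain ⟨a, haA, ha⟩ := hA.exists_isGreatest hAn
  obtain ⟨b, hbB, hb⟩ := hB.exists_isLeast hBn
  have h1 : ((fun x => x + b) '' A) ∪ ((fun x => a + x) '' B) ⊆ A + B := by
    rintro _ (⟨x, hx, rfl⟩ | ⟨x, hx, rfl⟩)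
    · exact Set.add_mem_add hx hbB
    · exact Set.add_mem_add haA hx
  have h2 : volume ((fun x => x + b) '' A) = volume A := by
    simp [Set.image_add_right, measure_preimage_add_right]
  have h3 : volume ((fun x => a + x) '' B) = volume B := by
    simp [Set.image_add_left, measure_preimage_add]
  have h4 : AEDisjoint volume ((fun x => x + b) '' A) ((fun x => a + x) '' B) := by
    have : ((fun x => x + b) '' A) ∩ ((fun x => a + x) '' B) ⊆ {a + b} := by
      rintro _ ⟨⟨x, hx, rfl⟩, ⟨y, hy, hxy⟩⟩
      have := ha hx
      have := hb hy
      simp only [Set.mem_singleton_iff] at *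
      linarith
    exact measure_mono_null this (by simp)
  have hm : MeasurableSet ((fun x => a + x) '' B) :=
    (hB.image (by fun_prop)).measurableSet
  rw [← h2, ← h3, ← measure_union₀ hm.nullMeasurableSet h4]
  exact measure_mono h1

theorem bm_one {A B C : Set ℝ} (hA : MeasurableSet A) (hB : MeasurableSet B)
    (hAn : A.Nonempty) (hBn : B.Nonempty) (hC : A + B ⊆ C) :
    volume A + volume B ≤ volume C := by
  have key : ∀ S : Set ℝ, MeasurableSet S → S.Nonempty → ∀ r < volume S,
      ∃ K ⊆ S, IsCompact K ∧ K.Nonempty ∧ r < volume K := by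
    intro S hS hSn r hr
    obtain ⟨K, hK, hKc, hrK⟩ := hS.exists_lt_isCompact hr
    refine ⟨K, hK, hKc, ?_, hrK⟩
    by_contra hne
    rw [Set.not_nonempty_iff_eq_empty] at hne
    simp [hne] at hrK
  have key2 : ∀ S : Set ℝ, MeasurableSet S → S.Nonempty → 
      ∀ c, (∀ K ⊆ S, IsCompact K → K.Nonempty → volume K ≤ c) → volume S ≤ c := by
    intro S hS hSn c h
    refine le_of_forall_lt fun r hr => ?_
    obtain ⟨K, h1, h2, h3, h4⟩ := key S hS hSn r hr
    exact h4.trans_le (h K h1 h2 h3)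
  by_cases hfin : volume C = ⊤
  · simp [hfin]
  obtain ⟨a0, ha0⟩ := hAn
  obtain ⟨b0, hb0⟩ := hBn
  have step : ∀ K ⊆ A, IsCompact K → K.Nonempty → ∀ L ⊆ B, IsCompact L → L.Nonempty →
      volume K + volume L ≤ volume C := fun K h1 h2 h3 L h4 h5 h6 =>
    (bm_one_compact h2 h5 h3 h6).trans (measure_mono ((Set.add_subset_add h1 h4).trans hC))
  have hle : ∀ K ⊆ A, IsCompact K → K.Nonempty → volume K + volume B ≤ volume C := by
    intro K h1 h2 h3
    have hKt : volume K ≠ ⊤ := h2.measure_lt_top.ne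
    have hKC : volume K ≤ volume C := by
      have := step K h1 h2 h3 {b0} (by simpa using hb0) isCompact_singleton (by simp)
      simpa using this
    have : volume B ≤ volume C - volume K := by
      refine key2 B hB ⟨b0, hb0⟩ _ fun L h4 h5 h6 => ?_
      exact ENNReal.le_sub_of_add_le_left hKt (step K h1 h2 h3 L h4 h5 h6)
    calc _ ≤ volume K + (volume C - volume K) := by gcongr
      _ = _ := add_tsub_cancel_of_le hKC
  have hBC : volume B ≤ volume C := by
    have := hle {a0} (by simpa using ha0) isCompact_singleton (by simp)
    simpa using this
  have hBt : volume B ≠ ⊤ := (hBC.trans_lt (lt_top_iff_ne_top.2 hfin)).ne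
  have : volume A ≤ volume C - volume B := by
    refine key2 A hA ⟨a0, ha0⟩ _ fun L h4 h5 h6 => ?_
    exact ENNReal.le_sub_of_add_le_right hBt (hle L h4 h5 h6)
  calc _ ≤ (volume C - volume B) + volume B := by gcongr
      _ = _ := tsub_add_cancel_of_le hBC

theorem ennreal_amgm {t : ℝ} (ht0 : 0 < t) (ht1 : t < 1) (u v : ENNReal) :
    u ^ t * v ^ (1 - t) ≤ ENNReal.ofReal t * u + ENNReal.ofReal (1 - t) * v := by
  have h := ENNReal.young_inequality (u ^ t) (v ^ (1 - t)) (p := t⁻¹) (q := (1-t)⁻¹)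
    (by rw [Real.holderConjugate_iff]; constructor
        · exact (one_lt_inv₀ ht0).2 ht1
        · simp)
  have h1 : 0 < 1 - t := by linarith
  rw [← ENNReal.rpow_mul, ← ENNReal.rpow_mul, mul_inv_cancel₀ ht0.ne', mul_inv_cancel₀ h1.ne',
    ENNReal.rpow_one, ENNReal.rpow_one, ENNReal.ofReal_inv_of_pos ht0,
    ENNReal.ofReal_inv_of_pos h1] at h
  simpa [div_eq_mul_inv, mul_comm] using h

theorem layer {f : ℝ → ENNReal} (hf : Measurable f) (hf1 : ∀ x, f x ≤ 1) :
    ∫⁻ x, f x = ∫⁻ s in Set.Ioo (0:ℝ) 1, volume {x | ENNReal.ofReal s < f x} := by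
  have hft : ∀ x, f x ≠ ⊤ := fun x => ne_top_of_le_ne_top ENNReal.one_ne_top (hf1 x)
  have h := lintegral_eq_lintegral_meas_lt volume (f := fun x => (f x).toReal)
    (Filter.Eventually.of_forall fun x => ENNReal.toReal_nonneg) hf.ennreal_toReal.aemeasurable
  simp_rw [ENNReal.ofReal_toReal (hft _)] at h
  rw [h]
  have h2 : ∫⁻ s in Set.Ioi (0:ℝ), volume {x | s < (f x).toReal}
      = ∫⁻ s in Set.Ioi (0:ℝ), volume {x | ENNReal.ofReal s < f x} := by
    refine setLIntegral_congr_fun measurableSet_Ioi fun s hs => ?_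
    simp only [ENNReal.ofReal_lt_iff_lt_toReal (le_of_lt hs) (hft _)]
  rw [h2]
  symm
  rw [← lintegral_indicator measurableSet_Ioo, ← lintegral_indicator measurableSet_Ioi]
  congr 1
  ext s
  by_cases h0 : 0 < s
  · by_cases h1 : s < 1
    · simp [h0, h1]
    · have : {x | ENNReal.ofReal s < f x} = ∅ := by
        ext x
        simp only [Set.mem_ofPred_eq, Set.mem_empty_iff_false, iff_false, not_lt]
        exact (hf1 x).trans (by simpa using not_lt.1 h1)
      rw [Set.indicator_of_notMem (by simp [h1]), Set.indicator_of_mem (Set.mem_Ioi.2 h0), this,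
        measure_empty]
  · simp [h0]

theorem pl_one_norm {t : ℝ} (ht0 : 0 < t) (ht1 : t < 1) {f g h : ℝ → ENNReal}
    (hf : Measurable f) (hg : Measurable g) (hh : Measurable h)
    (hf1 : (⨆ x, f x) = 1) (hg1 : (⨆ x, g x) = 1)
    (H : ∀ x y, f x ^ t * g y ^ (1 - t) ≤ h (t * x + (1 - t) * y)) :
    ENNReal.ofReal t * (∫⁻ x, f x) + ENNReal.ofReal (1 - t) * (∫⁻ x, g x) ≤ ∫⁻ x, h x := by
  have ht2 : 0 < 1 - t := by linarith
  have hmin : ∫⁻ x, min (h x) 1 ≤ ∫⁻ x, h x := lintegral_mono fun x => min_le_left _ _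
  refine le_trans ?_ hmin
  rw [layer hf (fun x => hf1 ▸ le_iSup f x), layer hg (fun x => hg1 ▸ le_iSup g x),
    layer (f := fun x => min (h x) 1) (hh.min measurable_const) (fun x => min_le_right _ _),
    ← lintegral_const_mul' _ _ ENNReal.ofReal_ne_top,
    ← lintegral_const_mul' _ _ ENNReal.ofReal_ne_top, ← lintegral_add_left']
  · refine setLIntegral_mono' measurableSet_Ioo fun s hs => ?_
    have hs1 : ENNReal.ofReal s < 1 := by
      rw [← ENNReal.ofReal_one]; exact (ENNReal.ofReal_lt_ofReal_iff one_pos).2 hs.2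
    have hs0 : ENNReal.ofReal s ≠ 0 := by simpa using hs.1
    have e1 : {x | ENNReal.ofReal s < f x}.Nonempty := by
      rw [← hf1] at hs1; exact lt_iSup_iff.1 hs1
    have e2 : {x | ENNReal.ofReal s < g x}.Nonempty := by
      rw [← hg1] at hs1; exact lt_iSup_iff.1 hs1
    have m1 : MeasurableSet {x | ENNReal.ofReal s < f x} := measurableSet_lt measurable_const hf
    have m2 : MeasurableSet {x | ENNReal.ofReal s < g x} := measurableSet_lt measurable_const hg
    have k := bm_one (A := t • {x | ENNReal.ofReal s < f x})
      (B := (1 - t) • {x | ENNReal.ofReal s < g x})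
      (C := {x | ENNReal.ofReal s < min (h x) 1})
      (m1.const_smul₀ t) (m2.const_smul₀ (1 - t)) (e1.smul_set) (e2.smul_set) ?_
    · simpa [Measure.addHaar_smul, abs_of_pos ht0, abs_of_pos ht2] using k
    · rintro _ ⟨_, ⟨x, hx, rfl⟩, _, ⟨y, hy, rfl⟩, rfl⟩
      simp only [Set.mem_ofPred_eq, lt_min_iff, smul_eq_mul] at *
      refine ⟨lt_of_lt_of_le ?_ (H x y), hs1⟩
      calc ENNReal.ofReal s = ENNReal.ofReal s ^ t * ENNReal.ofReal s ^ (1 - t) := by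
            rw [← ENNReal.rpow_add _ _ hs0 ENNReal.ofReal_ne_top]; simp
        _ < _ := ENNReal.mul_lt_mul (ENNReal.rpow_lt_rpow hx ht0) (ENNReal.rpow_lt_rpow hy ht2)
  · refine AEMeasurable.const_mul ?_ _
    refine (Antitone.measurable ?_).aemeasurable
    intro a b hab
    refine measure_mono fun x hx => ?_
    exact lt_of_le_of_lt (ENNReal.ofReal_le_ofReal hab) hx

theorem pl_one_bdd {t : ℝ} (ht0 : 0 < t) (ht1 : t < 1) {f g h : ℝ → ENNReal}
    (hf : Measurable f) (hg : Measurable g) (hh : Measurable h)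
    (hfb : (⨆ x, f x) ≠ ⊤) (hgb : (⨆ x, g x) ≠ ⊤)
    (H : ∀ x y, f x ^ t * g y ^ (1 - t) ≤ h (t * x + (1 - t) * y)) :
    (∫⁻ x, f x) ^ t * (∫⁻ x, g x) ^ (1 - t) ≤ ∫⁻ x, h x := by
  have ht2 : 0 < 1 - t := by linarith
  set a := ⨆ x, f x with ha
  set b := ⨆ x, g x with hb
  by_cases ha0 : a = 0
  · have : ∀ x, f x = 0 := fun x => le_antisymm (ha0 ▸ le_iSup f x) bot_le
    simp [this, ht0]
  by_cases hb0 : b = 0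
  · have : ∀ x, g x = 0 := fun x => le_antisymm (hb0 ▸ le_iSup g x) bot_le
    simp [this, ht2]
  set c := a ^ t * b ^ (1 - t) with hc
  have hat0 : a ^ t ≠ 0 := by simp [ENNReal.rpow_eq_zero_iff, ha0, hfb]
  have hbt0 : b ^ (1 - t) ≠ 0 := by simp [ENNReal.rpow_eq_zero_iff, hb0, hgb]
  have hat : a ^ t ≠ ⊤ := ENNReal.rpow_ne_top_of_nonneg ht0.le hfb
  have hbt : b ^ (1 - t) ≠ ⊤ := ENNReal.rpow_ne_top_of_nonneg ht2.le hgb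
  have hc0 : c ≠ 0 := mul_ne_zero hat0 hbt0
  have hct : c ≠ ⊤ := ENNReal.mul_ne_top hat hbt
  have hci : c⁻¹ = (a⁻¹) ^ t * (b⁻¹) ^ (1 - t) := by
    rw [hc, ENNReal.mul_inv (Or.inl hat0) (Or.inl hat), ENNReal.inv_rpow, ENNReal.inv_rpow]
  have key := pl_one_norm ht0 ht1 (f := fun x => a⁻¹ * f x) (g := fun x => b⁻¹ * g x)
    (h := fun x => c⁻¹ * h x) (hf.const_mul _) (hg.const_mul _) (hh.const_mul _)
    (by rw [← ENNReal.mul_iSup, ← ha]; exact ENNReal.inv_mul_cancel ha0 hfb)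
    (by rw [← ENNReal.mul_iSup, ← hb]; exact ENNReal.inv_mul_cancel hb0 hgb)
    (by
      intro x y
      rw [ENNReal.mul_rpow_of_nonneg _ _ ht0.le, ENNReal.mul_rpow_of_nonneg _ _ ht2.le, hci]
      calc _ = (a⁻¹) ^ t * (b⁻¹) ^ (1 - t) * (f x ^ t * g y ^ (1 - t)) := by ring
        _ ≤ _ := by gcongr; exact H x y)
  have key2 := (ennreal_amgm ht0 ht1 _ _).trans key
  rw [lintegral_const_mul _ hf, lintegral_const_mul _ hg, lintegral_const_mul _ hh,
    ENNReal.mul_rpow_of_nonneg _ _ ht0.le, ENNReal.mul_rpow_of_nonneg _ _ ht2.le] at key2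
  have key3 : c⁻¹ * ((∫⁻ x, f x) ^ t * (∫⁻ x, g x) ^ (1 - t)) ≤ c⁻¹ * ∫⁻ x, h x := by
    refine le_trans (le_of_eq ?_) key2
    rw [hci]; ring
  exact (ENNReal.mul_le_mul_iff_right (by simpa using hct) (by simpa using hc0)).1 key3

theorem tendsto_trunc {f : ℝ → ENNReal} (hf : Measurable f) :
    Filter.Tendsto (fun N : ℕ => ∫⁻ x, min (f x) N) Filter.atTop (nhds (∫⁻ x, f x)) := by
  refine lintegral_tendsto_of_tendsto_of_monotone
    (fun N => (hf.min measurable_const).aemeasurable) ?_ ?_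
  · refine Filter.Eventually.of_forall fun x => ?_
    intro N M hNM
    exact min_le_min le_rfl (by exact_mod_cast hNM)
  · refine Filter.Eventually.of_forall fun x => ?_
    have : Filter.Tendsto (fun N : ℕ => min (f x) (N : ENNReal)) Filter.atTop
        (nhds (min (f x) ⊤)) := tendsto_const_nhds.min ENNReal.tendsto_nat_nhds_top
    simpa using this

theorem pl_one {t : ℝ} (ht0 : 0 < t) (ht1 : t < 1) {f g h : ℝ → ENNReal}
    (hf : Measurable f) (hg : Measurable g) (hh : Measurable h)
    (H : ∀ x y, f x ^ t * g y ^ (1 - t) ≤ h (t * x + (1 - t) * y)) :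
    (∫⁻ x, f x) ^ t * (∫⁻ x, g x) ^ (1 - t) ≤ ∫⁻ x, h x := by
  have ht2 : 0 < 1 - t := by linarith
  by_cases h1 : ∫⁻ x, f x = 0
  · simp [h1, ht0]
  by_cases h2 : ∫⁻ x, g x = 0
  · simp [h2, ht2]
  have e1 : (∫⁻ x, f x) ^ t ≠ 0 := by simp [ENNReal.rpow_eq_zero_iff, h1, ht0.le]
  have e2 : (∫⁻ x, g x) ^ (1 - t) ≠ 0 := by
    simp only [ne_eq, ENNReal.rpow_eq_zero_iff, h2, false_and, false_or, not_and, not_lt]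
    exact fun _ => ht2.le
  have T := ENNReal.Tendsto.mul
    ((ENNReal.continuous_rpow_const (y := t)).continuousAt.tendsto.comp (tendsto_trunc hf))
    (Or.inl e1)
    ((ENNReal.continuous_rpow_const (y := 1 - t)).continuousAt.tendsto.comp (tendsto_trunc hg))
    (Or.inl e2)
  refine le_of_tendsto' T fun N => ?_
  have hb : ∀ u : ℝ → ENNReal, (⨆ x, min (u x) (N : ENNReal)) ≠ ⊤ := fun u =>
    ne_top_of_le_ne_top (ENNReal.natCast_ne_top N) (iSup_le fun x => min_le_right _ _)
  refine pl_one_bdd ht0 ht1 (hf.min measurable_const) (hg.min measurable_const) hh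
    (hb f) (hb g) fun x y => le_trans ?_ (H x y)
  gcongr
  · exact min_le_left _ _
  · exact min_le_left _ _

/-- Prékopa–Leindler inequality. -/
theorem pl_pi {t : ℝ} (ht0 : 0 < t) (ht1 : t < 1) (n : ℕ) : ∀ {f g h : (Fin n → ℝ) → ENNReal}
    (_ : Measurable f) (_ : Measurable g) (_ : Measurable h)
    (_ : ∀ x y, f x ^ t * g y ^ (1 - t) ≤ h (t • x + (1 - t) • y)),
    (∫⁻ x, f x) ^ t * (∫⁻ x, g x) ^ (1 - t) ≤ ∫⁻ x, h x := by
  induction n with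
  | zero =>
    intro f g h hf hg hh H
    have e : ∀ u : (Fin 0 → ℝ) → ENNReal, ∫⁻ x, u x = u default := by
      intro u
      rw [lintegral_unique]
      simp [volume_pi]
      congr 1
      exact Subsingleton.elim _ _
    rw [e, e, e]
    refine (H default default).trans (le_of_eq ?_)
    congr 1
    exact Subsingleton.elim _ _
  | succ n ih =>
    intro f g h hf hg hh H
    have mp := (volume_preserving_piFinSuccAbove (fun _ : Fin (n+1) => ℝ) 0).symm
    have e : ∀ u : (Fin (n+1) → ℝ) → ENNReal, Measurable u →
        Measurable (fun a : ℝ => ∫⁻ z : Fin n → ℝ, u (Fin.cons a z)) ∧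
        ∫⁻ x, u x = ∫⁻ a : ℝ, ∫⁻ z : Fin n → ℝ, u (Fin.cons a z) := by
      intro u hu
      have hm := mp.measurable
      have hum : Measurable fun p : ℝ × (Fin n → ℝ) =>
          u ((MeasurableEquiv.piFinSuccAbove (fun _ : Fin (n+1) => ℝ) 0).symm p) := hu.comp hm
      constructor
      · have := hum.lintegral_prod_right' (ν := volume)
        simpa [MeasurableEquiv.piFinSuccAbove, Fin.consEquiv] using this
      · rw [← mp.lintegral_comp hu, Measure.volume_eq_prod, lintegral_prod _ hum.aemeasurable]
        simp [MeasurableEquiv.piFinSuccAbove, Fin.consEquiv]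
    have hcm : ∀ a : ℝ, Measurable fun z : Fin n → ℝ => (Fin.cons a z : Fin (n+1) → ℝ) := by
      intro a
      refine measurable_pi_iff.2 fun i => ?_
      refine Fin.cases ?_ (fun j => ?_) i
      · simp
      · simp only [Fin.cons_succ]; exact measurable_pi_apply j
    rw [(e f hf).2, (e g hg).2, (e h hh).2]
    refine pl_one ht0 ht1 (e f hf).1 (e g hg).1 (e h hh).1 fun a b => ?_
    refine ih (hf.comp (hcm a)) (hg.comp (hcm b)) (hh.comp (hcm _)) fun x y => ?_
    refine (H (Fin.cons a x) (Fin.cons b y)).trans (le_of_eq ?_)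
    congr 1
    ext i
    refine Fin.cases ?_ (fun j => ?_) i <;> simp

/-- Brunn–Minkowski, in the form used below. -/
theorem bm_euclid {n : ℕ} {A B C : Set (EuclideanSpace ℝ (Fin n))}
    (hA : MeasurableSet A) (hB : MeasurableSet B) (hC : MeasurableSet C)
    {a b : ℝ} (ha : 0 < a) (hb : 0 < b) (hAv : volume A = ENNReal.ofReal (a ^ n))
    (hBv : volume B = ENNReal.ofReal (b ^ n)) (hABC : A + B ⊆ C) :
    ENNReal.ofReal ((a + b) ^ n) ≤ volume C := by
  have hab : 0 < a + b := by positivity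
  set t := a / (a + b) with ht
  have ht0 : 0 < t := by positivity
  have ht2 : 1 - t = b / (a + b) := by rw [ht]; field_simp; ring
  have ht20 : 0 < 1 - t := by rw [ht2]; positivity
  have ht1 : t < 1 := by linarith
  have mp := EuclideanSpace.volume_preserving_symm_measurableEquiv_toLp (Fin n)
  set φ := (MeasurableEquiv.toLp 2 (Fin n → ℝ)) with hφ
  have hφa : ∀ x, φ x = WithLp.toLp 2 x := fun x => rfl
  have hvol : ∀ S : Set (EuclideanSpace ℝ (Fin n)), MeasurableSet S →
      ∫⁻ x : Fin n → ℝ, S.indicator (fun _ => (1:ENNReal)) (φ x) = volume S := by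
    intro S hS
    have h := mp.symm.lintegral_comp (f := S.indicator (fun _ => (1:ENNReal)))
      (measurable_const.indicator hS)
    rw [MeasurableEquiv.symm_symm] at h
    rw [h, lintegral_indicator hS]
    simp
  have hmeas : ∀ S : Set (EuclideanSpace ℝ (Fin n)), MeasurableSet S →
      Measurable (fun x : Fin n → ℝ => S.indicator (fun _ => (1:ENNReal)) (φ x)) := fun S hS =>
    (measurable_const.indicator hS).comp φ.measurable
  have mA : MeasurableSet (t⁻¹ • A) := hA.const_smul₀ _
  have mB : MeasurableSet ((1-t)⁻¹ • B) := hB.const_smul₀ _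
  have key := pl_pi ht0 ht1 n (hmeas _ mA) (hmeas _ mB) (hmeas C hC) (by
    intro x y
    by_cases hx : φ x ∈ t⁻¹ • A
    · by_cases hy : φ y ∈ (1-t)⁻¹ • B
      · have : φ (t • x + (1 - t) • y) ∈ C := by
          apply hABC
          have e : φ (t • x + (1 - t) • y) = t • φ x + (1 - t) • φ y := by
            simp [hφa]
          rw [e]
          refine Set.add_mem_add ?_ ?_
          · rwa [Set.mem_inv_smul_set_iff₀ ht0.ne'] at hx
          · rwa [Set.mem_inv_smul_set_iff₀ ht20.ne'] at hy
        simp [hx, hy, this]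
      · simp [hy, ht20]
    · simp [hx, ht0])
  rw [hvol _ mA, hvol _ mB, hvol _ hC] at key
  have vA : volume (t⁻¹ • A) = ENNReal.ofReal ((a + b) ^ n) := by
    rw [Measure.addHaar_smul, hAv, finrank_euclideanSpace_fin, ← ENNReal.ofReal_mul (by positivity),
      abs_of_pos (by positivity), ← mul_pow, ht]
    congr 2; field_simp
  have vB : volume ((1-t)⁻¹ • B) = ENNReal.ofReal ((a + b) ^ n) := by
    rw [Measure.addHaar_smul, hBv, finrank_euclideanSpace_fin, ← ENNReal.ofReal_mul (by positivity),
      abs_of_pos (by positivity), ← mul_pow, ht2]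
    congr 2; field_simp
  rw [vA, vB, ← ENNReal.rpow_add _ _ (by simp; positivity) ENNReal.ofReal_ne_top] at key
  simpa using key

theorem pow_bern {x y : ℝ} (hx : 0 < x) (hy : 0 ≤ y) (n : ℕ) (hn : 1 ≤ n) :
    x ^ n + n * x ^ (n - 1) * y ≤ (x + y) ^ n := by
  obtain ⟨m, rfl⟩ : ∃ m, n = m + 1 := ⟨n - 1, by omega⟩
  have h := one_add_mul_le_pow (a := y / x) (by have : 0 ≤ y / x := by positivity
                                                linarith) (m + 1)
  have e : (x + y) ^ (m + 1) = x ^ (m + 1) * (1 + y / x) ^ (m + 1) := by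
    rw [← mul_pow]; congr 1; field_simp
  rw [e]
  refine le_trans (le_of_eq ?_) (mul_le_mul_of_nonneg_left h (by positivity))
  simp only [Nat.add_sub_cancel]
  field_simp
  ring

theorem level_step {n : ℕ} (hn : 1 ≤ n) {f : EuclideanSpace ℝ (Fin n) → ℝ} (hf : Measurable f)
    {K : Set (EuclideanSpace ℝ (Fin n))} (hKm : MeasurableSet K)
    {k : ℝ} (hk : 0 < k) (hKv : volume K = ENNReal.ofReal (k ^ n)) (hfK : ∀ x ∉ K, f x = 0)
    (hstar : ∀ t, 0 < t → t < 1 → ∀ x, ∀ y ∈ K, t ^ n * f x ≤ f (t • x + (1 - t) • y))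
    {t : ℝ} (ht0 : 0 < t) (ht1 : t < 1) {τ : ℝ} (hτ : 0 < τ) :
    ENNReal.ofReal (t ^ n) * volume {x | τ < f x} +
      ENNReal.ofReal (n * t ^ (n - 1) * (1 - t) * k) *
        (volume {x | τ < f x} * volume {x | τ < f x} ^ (-(1 / n : ℝ)))
      ≤ volume {x | t ^ n * τ < f x} := by
  have ht2 : 0 < 1 - t := by linarith
  have hn0 : (n : ℝ) ≠ 0 := by positivity
  have hsub : {x | τ < f x} ⊆ K := by
    intro x hx
    by_contra hxK
    have h0 := hfK x hxK
    simp only [Set.mem_ofPred_eq] at hx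
    linarith
  have hm : MeasurableSet {x | τ < f x} := measurableSet_lt measurable_const hf
  have hVt : volume {x | τ < f x} ≠ ⊤ :=
    ne_top_of_le_ne_top (by rw [hKv]; exact ENNReal.ofReal_ne_top) (measure_mono hsub)
  by_cases hV0 : volume {x | τ < f x} = 0
  · simp [hV0]
  set V := volume {x | τ < f x} with hV
  have hVpos : 0 < V.toReal := ENNReal.toReal_pos hV0 hVt
  set a := V.toReal ^ (1 / n : ℝ) with ha
  have hapos : 0 < a := by positivity
  have han : a ^ n = V.toReal := by
    rw [ha, ← Real.rpow_natCast, ← Real.rpow_mul hVpos.le]; field_simp; simp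
  have hVa : V = ENNReal.ofReal (a ^ n) := by rw [han, ENNReal.ofReal_toReal hVt]
  have hVi : V ^ (-(1 / n : ℝ)) = ENNReal.ofReal a⁻¹ := by
    rw [hVa, ENNReal.ofReal_rpow_of_pos (by positivity), ← Real.rpow_natCast,
      ← Real.rpow_mul hapos.le]
    congr 1
    rw [← Real.rpow_neg_one]
    congr 1
    field_simp
  have hVV : V * V ^ (-(1 / n : ℝ)) = ENNReal.ofReal (a ^ (n - 1)) := by
    rw [hVi, hVa, ← ENNReal.ofReal_mul (by positivity)]
    congr 1
    obtain ⟨m, rfl⟩ : ∃ m, n = m + 1 := ⟨n - 1, by omega⟩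
    simp only [Nat.add_sub_cancel]
    field_simp
    ring
  have hbm := bm_euclid (A := t • {x | τ < f x}) (B := (1 - t) • K)
    (C := {x | t ^ n * τ < f x}) (hm.const_smul₀ _) (hKm.const_smul₀ _)
    (measurableSet_lt measurable_const hf) (a := t * a) (b := (1 - t) * k) (by positivity)
    (by positivity)
    (by rw [Measure.addHaar_smul, ← hV, hVa, finrank_euclideanSpace_fin,
          ← ENNReal.ofReal_mul (by positivity), abs_of_pos (by positivity), mul_pow])
    (by rw [Measure.addHaar_smul, hKv, finrank_euclideanSpace_fin,
          ← ENNReal.ofReal_mul (by positivity), abs_of_pos (by positivity), mul_pow])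
    (by
      rintro _ ⟨_, ⟨x, hx, rfl⟩, _, ⟨y, hy, rfl⟩, rfl⟩
      simp only [Set.mem_ofPred_eq] at *
      exact lt_of_lt_of_le (mul_lt_mul_of_pos_left hx (by positivity)) (hstar t ht0 ht1 x y hy))
  refine le_trans ?_ hbm
  rw [hVV, hVa, ← ENNReal.ofReal_mul (by positivity), ← ENNReal.ofReal_mul (by positivity),
    ← ENNReal.ofReal_add (by positivity) (by positivity)]
  apply ENNReal.ofReal_le_ofReal
  refine le_trans (le_of_eq ?_) (pow_bern (x := t * a) (y := (1 - t) * k) (by positivity)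
    (by positivity) n hn)
  rw [mul_pow, mul_pow]; ring

theorem level_bound {n : ℕ} (hn : 1 ≤ n) {f : EuclideanSpace ℝ (Fin n) → ℝ} (hf : Measurable f)
    (f0 : ∀ x, 0 ≤ f x)
    {K : Set (EuclideanSpace ℝ (Fin n))} (hKm : MeasurableSet K)
    {k : ℝ} (hk : 0 < k) (hKv : volume K = ENNReal.ofReal (k ^ n)) (hfK : ∀ x ∉ K, f x = 0)
    (hf1 : ∫⁻ x, ENNReal.ofReal (f x) = 1)
    (hstar : ∀ t, 0 < t → t < 1 → ∀ x, ∀ y ∈ K, t ^ n * f x ≤ f (t • x + (1 - t) • y)) :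
    ∫⁻ τ in Set.Ioi (0:ℝ), (volume {x | τ < f x} * volume {x | τ < f x} ^ (-(1 / n : ℝ)))
      ≤ ENNReal.ofReal (2 / k) := by
  have hnpos : (0:ℝ) < n := by positivity
  set J := ∫⁻ τ in Set.Ioi (0:ℝ),
    (volume {x | τ < f x} * volume {x | τ < f x} ^ (-(1 / n : ℝ))) with hJ
  have hVmeas : Measurable fun τ : ℝ => volume {x | τ < f x} := by
    refine Antitone.measurable fun a b hab => measure_mono fun x hx => ?_
    exact lt_of_le_of_lt hab hx
  have hlay : ∀ t : ℝ, 0 < t →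
      ∫⁻ τ in Set.Ioi (0:ℝ), volume {x | t ^ n * τ < f x} = ENNReal.ofReal ((t ^ n)⁻¹) := by
    intro t ht
    have h := lintegral_eq_lintegral_meas_lt (volume : Measure (EuclideanSpace ℝ (Fin n)))
      (f := fun x => (t ^ n)⁻¹ * f x)
      (Filter.Eventually.of_forall fun x => mul_nonneg (by positivity) (f0 x))
      (hf.const_mul _).aemeasurable
    have e : ∀ τ x, (τ < (t ^ n)⁻¹ * f x) ↔ t ^ n * τ < f x := by
      intro τ x
      rw [lt_inv_mul_iff₀ (by positivity)]
    simp_rw [e] at h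
    rw [← h]
    simp_rw [ENNReal.ofReal_mul (show 0 ≤ (t ^ n)⁻¹ by positivity)]
    rw [lintegral_const_mul' _ _ ENNReal.ofReal_ne_top, hf1, mul_one]
  have hlay1 := hlay 1 one_pos
  simp only [one_pow, one_mul, inv_one, ENNReal.ofReal_one] at hlay1
  have hstep : ∀ t : ℝ, 0 < t → t < 1 → ENNReal.ofReal (t ^ n) +
      ENNReal.ofReal (n * t ^ (n - 1) * (1 - t) * k) * J ≤ ENNReal.ofReal ((t ^ n)⁻¹) := by
    intro t ht0 ht1
    rw [← hlay t ht0, hJ]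
    nth_rw 1 [← mul_one (ENNReal.ofReal (t ^ n))]
    rw [← hlay1, ← lintegral_const_mul' _ _ ENNReal.ofReal_ne_top,
      ← lintegral_const_mul' _ _ ENNReal.ofReal_ne_top,
      ← lintegral_add_left (hVmeas.const_mul _)]
    exact setLIntegral_mono' measurableSet_Ioi fun τ hτ =>
      level_step hn hf hKm hk hKv hfK hstar ht0 ht1 hτ
  have hJt : J ≠ ⊤ := by
    intro h
    have := hstep (1/2) (by norm_num) (by norm_num)
    rw [h, ENNReal.mul_top] at this
    · simp at this
    · simp only [ne_eq, ENNReal.ofReal_eq_zero, not_le]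
      norm_num
      positivity
  set j := J.toReal with hj
  have hj0 : 0 ≤ j := ENNReal.toReal_nonneg
  have hreal : ∀ t : ℝ, 0 < t → t < 1 → k * j * t ^ (2 * n - 1) ≤ 2 := by
    intro t ht0 ht1
    have ht2 : 0 < 1 - t := by linarith
    have h := hstep t ht0 ht1
    rw [← ENNReal.ofReal_toReal hJt, ← ENNReal.ofReal_mul (by positivity),
      ← ENNReal.ofReal_add (by positivity) (by positivity),
      ENNReal.ofReal_le_ofReal_iff (by positivity), ← hj] at h
    have h2 := mul_le_mul_of_nonneg_left h (show 0 ≤ t ^ n by positivity)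
    rw [mul_inv_cancel₀ (by positivity)] at h2
    have hg : 1 - t ^ (2 * n) ≤ (1 - t) * (2 * n) := by
      have := one_add_mul_le_pow (a := t - 1) (by linarith) (2 * n)
      simp only [add_sub_cancel] at this
      push_cast at this
      nlinarith
    have e : t ^ n * (t ^ n + n * t ^ (n - 1) * (1 - t) * k * j)
        = t ^ (2 * n) + (1 - t) * n * (k * j * t ^ (2 * n - 1)) := by
      have e1 : t ^ (2 * n) = t ^ n * t ^ n := by rw [two_mul, pow_add]
      have e2 : t ^ (2 * n - 1) = t ^ n * t ^ (n - 1) := by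
        rw [← pow_add]; congr 1; omega
      rw [e1, e2]; ring
    rw [e] at h2
    have h3 : ((1 - t) * n) * (k * j * t ^ (2 * n - 1)) ≤ ((1 - t) * n) * 2 := by linarith
    exact le_of_mul_le_mul_left h3 (by positivity)
  have hlim : k * j ≤ 2 := by
    have hc : Filter.Tendsto (fun t : ℝ => k * j * t ^ (2 * n - 1)) (nhdsWithin 1 (Set.Iio 1))
        (nhds (k * j * 1 ^ (2 * n - 1))) := by
      apply Filter.Tendsto.mono_left _ nhdsWithin_le_nhds
      exact Continuous.tendsto (by fun_prop) 1
    rw [one_pow, mul_one] at hc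
    refine le_of_tendsto hc ?_
    filter_upwards [Ioo_mem_nhdsLT (show (0:ℝ) < 1 by norm_num)] with t ht
    exact hreal t ht.1 ht.2
  rw [← ENNReal.ofReal_toReal hJt]
  apply ENNReal.ofReal_le_ofReal
  rw [le_div_iff₀ hk]; linarith

theorem core {n : ℕ} (hn : 1 ≤ n) {f : EuclideanSpace ℝ (Fin n) → ℝ} (hf : Measurable f)
    (f0 : ∀ x, 0 ≤ f x) {M : ℝ} (fM : ∀ x, f x ≤ M)
    {K : Set (EuclideanSpace ℝ (Fin n))} (hKm : MeasurableSet K)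
    {k : ℝ} (hk : 0 < k) (hKv : volume K = ENNReal.ofReal (k ^ n)) (hfK : ∀ x ∉ K, f x = 0)
    (hf1 : ∫⁻ x, ENNReal.ofReal (f x) = 1)
    (hstar : ∀ t, 0 < t → t < 1 → ∀ x, ∀ y ∈ K, t ^ n * f x ≤ f (t • x + (1 - t) • y)) :
    ∫ x, f x * Real.log (f x) ≤ n * Real.log 2 - n * Real.log k := by
  have hnpos : (0:ℝ) < n := by positivity
  have hJ := level_bound hn hf f0 hKm hk hKv hfK hf1 hstar
  set V : ℝ → ENNReal := fun τ => volume {x | τ < f x} with hV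
  have hVmeas : Measurable V := by
    refine Antitone.measurable fun a b hab => measure_mono fun x hx => ?_
    exact lt_of_le_of_lt hab hx
  have hVt : ∀ τ, 0 < τ → V τ ≠ ⊤ := by
    intro τ hτ
    refine ne_top_of_le_ne_top (by rw [hKv]; exact ENNReal.ofReal_ne_top)
      (measure_mono (t := K) ?_)
    intro x hx
    by_contra hxK
    have h0 := hfK x hxK
    simp only [Set.mem_ofPred_eq] at hx
    linarith
  have hlay : ∫⁻ τ in Set.Ioi (0:ℝ), V τ = 1 := by
    rw [← hf1, lintegral_eq_lintegral_meas_lt _ (Filter.Eventually.of_forall f0) hf.aemeasurable]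
  -- the kernel
  set C : ℝ := 1 + n + n * Real.log (k / 2) with hC
  set G : EuclideanSpace ℝ (Fin n) → ℝ → ENNReal := fun x τ =>
    ENNReal.ofReal (f x) * V τ + ENNReal.ofReal (n * k / 2) * V τ ^ (-(1 / n : ℝ)) with hG
  have hpt : ∀ x τ, 0 < τ → τ < f x → ENNReal.ofReal (Real.log (f x) + C) ≤ G x τ := by
    intro x τ hτ hx
    have hfx : 0 < f x := hτ.trans hx
    by_cases hV0 : V τ = 0
    · have : G x τ = ⊤ := by
        simp only [hG, hV0]
        rw [ENNReal.zero_rpow_of_neg (by simp; omega), ENNReal.mul_top]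
        · simp
        · simp only [ne_eq, ENNReal.ofReal_eq_zero, not_le]; positivity
      rw [this]; exact le_top
    set v := (V τ).toReal with hv
    have hvpos : 0 < v := ENNReal.toReal_pos hV0 (hVt τ hτ)
    have hVv : V τ = ENNReal.ofReal v := (ENNReal.ofReal_toReal (hVt τ hτ)).symm
    simp only [hG]
    rw [hVv, ENNReal.ofReal_rpow_of_pos hvpos, ← ENNReal.ofReal_mul hfx.le,
      ← ENNReal.ofReal_mul (by positivity), ← ENNReal.ofReal_add (by positivity) (by positivity)]
    apply ENNReal.ofReal_le_ofReal
    have h1 := Real.log_le_sub_one_of_pos (mul_pos hfx hvpos)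
    rw [Real.log_mul hfx.ne' hvpos.ne'] at h1
    set w := v ^ (-(1 / n : ℝ)) with hw
    have hwpos : 0 < w := by positivity
    have h2 := Real.log_le_sub_one_of_pos (mul_pos hwpos (show 0 < k / 2 by positivity))
    rw [Real.log_mul hwpos.ne' (by positivity), hw, Real.log_rpow hvpos, ← hw] at h2
    have h3 := mul_le_mul_of_nonneg_left h2 hnpos.le
    have h4 : (n:ℝ) * (-(1 / n : ℝ) * Real.log v + Real.log (k / 2))
        = - Real.log v + n * Real.log (k / 2) := by field_simp
    rw [h4] at h3
    have h5 : (n:ℝ) * (w * (k / 2) - 1) = n * k / 2 * w - n := by ring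
    linarith
  have hx : ∀ x, ENNReal.ofReal (f x * Real.log (f x) + C * f x) ≤
      ∫⁻ τ in Set.Ioi (0:ℝ), {p : EuclideanSpace ℝ (Fin n) × ℝ | p.2 < f p.1}.indicator
        (fun p => G p.1 p.2) (x, τ) := by
    intro x
    calc ENNReal.ofReal (f x * Real.log (f x) + C * f x)
        = ∫⁻ τ in Set.Ioo 0 (f x), ENNReal.ofReal (Real.log (f x) + C) := by
          rw [setLIntegral_const, Real.volume_Ioo, sub_zero,
            mul_comm (ENNReal.ofReal _), ← ENNReal.ofReal_mul (f0 x)]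
          congr 1; ring
      _ ≤ ∫⁻ τ in Set.Ioo 0 (f x), {p : EuclideanSpace ℝ (Fin n) × ℝ | p.2 < f p.1}.indicator
        (fun p => G p.1 p.2) (x, τ) := by
          refine setLIntegral_mono' measurableSet_Ioo fun τ hτ => ?_
          rw [Set.indicator_of_mem (show (x, τ) ∈ {p : EuclideanSpace ℝ (Fin n) × ℝ |
            p.2 < f p.1} from hτ.2)]
          exact hpt x τ hτ.1 hτ.2
      _ ≤ _ := lintegral_mono_set fun τ hτ => hτ.1
  have hS : MeasurableSet {p : EuclideanSpace ℝ (Fin n) × ℝ | p.2 < f p.1} :=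
    measurableSet_lt measurable_snd (hf.comp measurable_fst)
  have hGm : Measurable fun p : EuclideanSpace ℝ (Fin n) × ℝ => G p.1 p.2 := by
    simp only [hG]
    refine Measurable.add (Measurable.mul ?_ ?_) (Measurable.const_mul ?_ _)
    · exact (hf.comp measurable_fst).ennreal_ofReal
    · exact hVmeas.comp measurable_snd
    · exact (hVmeas.comp measurable_snd).pow_const _
  have hfinal : ∫⁻ x, ENNReal.ofReal (f x * Real.log (f x) + C * f x) ≤
      ENNReal.ofReal (1 + n) := by
    refine (lintegral_mono hx).trans ?_
    rw [lintegral_lintegral_swap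
      (f := fun x τ => {p : EuclideanSpace ℝ (Fin n) × ℝ | p.2 < f p.1}.indicator
        (fun p => G p.1 p.2) (x, τ)) (hGm.indicator hS).aemeasurable]
    calc _ ≤ ∫⁻ τ in Set.Ioi (0:ℝ), (V τ + ENNReal.ofReal (n * k / 2) *
            (V τ * V τ ^ (-(1 / n : ℝ)))) := by
          refine lintegral_mono fun τ => ?_
          have hm : MeasurableSet {x | τ < f x} := measurableSet_lt measurable_const hf
          have e : ∀ x, {p : EuclideanSpace ℝ (Fin n) × ℝ | p.2 < f p.1}.indicator
              (fun p => G p.1 p.2) (x, τ) = {x | τ < f x}.indicator (fun x => G x τ) x :=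
            fun x => rfl
          simp_rw [e]
          rw [lintegral_indicator hm]
          simp only [hG]
          rw [lintegral_add_right _ measurable_const, setLIntegral_const,
            lintegral_mul_const _ hf.ennreal_ofReal]
          refine add_le_add ?_ (le_of_eq (by simp only [hV]; ring))
          calc _ ≤ 1 * V τ := by
                gcongr
                rw [← hf1]; exact setLIntegral_le_lintegral _ _
            _ = _ := one_mul _
      _ = 1 + ENNReal.ofReal (n * k / 2) *
          ∫⁻ τ in Set.Ioi (0:ℝ), (V τ * V τ ^ (-(1 / n : ℝ))) := by
          rw [lintegral_add_left hVmeas, hlay, lintegral_const_mul' _ _ ENNReal.ofReal_ne_top]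
      _ ≤ 1 + ENNReal.ofReal (n * k / 2) * ENNReal.ofReal (2 / k) := by gcongr
      _ = ENNReal.ofReal (1 + n) := by
          rw [← ENNReal.ofReal_mul (by positivity), ENNReal.ofReal_add one_pos.le hnpos.le,
            ENNReal.ofReal_one]
          congr 2; field_simp
  -- integrability
  have hfint : Integrable f := by
    refine ⟨hf.aestronglyMeasurable, ?_⟩
    rw [hasFiniteIntegral_iff_ofReal (Filter.Eventually.of_forall f0), hf1]
    exact ENNReal.one_lt_top
  have hflog : Integrable fun x => f x * Real.log (f x) := by
    obtain ⟨D, hD⟩ := (isCompact_Icc (a := (0:ℝ)) (b := M)).exists_bound_of_continuousOn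
      Real.continuous_mul_log.continuousOn
    have hon : IntegrableOn (fun x => f x * Real.log (f x)) K := by
      refine Measure.integrableOn_of_bounded (M := D) (by rw [hKv]; exact ENNReal.ofReal_ne_top)
        (hf.mul (Real.measurable_log.comp hf)).aestronglyMeasurable ?_
      exact Filter.Eventually.of_forall fun x => hD (f x) ⟨f0 x, fM x⟩
    refine (integrableOn_iff_integrable_of_support_subset ?_).1 hon
    intro x hx
    by_contra hxK
    simp [hfK x hxK] at hx
  have hfi1 : ∫ x, f x = 1 := by
    rw [integral_eq_lintegral_of_nonneg_ae (Filter.Eventually.of_forall f0)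
      hf.aestronglyMeasurable, hf1]; simp
  have hsum : ∫ x, (f x * Real.log (f x) + C * f x) ≤ 1 + n := by
    have hint := hflog.add (hfint.const_mul C)
    have h1 := integral_eq_lintegral_pos_part_sub_lintegral_neg_part hint
    simp only [Pi.add_apply] at h1
    rw [h1]
    have h2 := ENNReal.toReal_mono ENNReal.ofReal_ne_top hfinal
    rw [ENNReal.toReal_ofReal (by positivity)] at h2
    have h3 : 0 ≤ (∫⁻ a, ENNReal.ofReal (-(f a * Real.log (f a) + C * f a))).toReal :=
      ENNReal.toReal_nonneg
    linarith
  rw [integral_add hflog (hfint.const_mul C), integral_const_mul, hfi1, hC,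
    Real.log_div hk.ne' (by norm_num)] at hsum
  linarith

theorem uniform_eq_withDensity {n : ℕ} {A : Set (EuclideanSpace ℝ (Fin n))}
    (hA : MeasurableSet A) (c : ENNReal) :
    c • (volume : Measure (EuclideanSpace ℝ (Fin n))).restrict A
      = volume.withDensity (A.indicator fun _ => c) := by
  rw [withDensity_indicator hA, withDensity_const]

/-- For independent random vectors `X₁, X₂` uniform on convex bodies
`A₁, A₂ ⊂ ℝⁿ`, the entropy of the sum satisfies
`h(X₁ + X₂) ≥ log |A₁ + A₂| - n log 2`, where `A₁ + A₂` is the Minkowski sum. -/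
theorem entropy_sum_of_uniforms_lower_bound
    {n : ℕ} (hn : 1 ≤ n)
    {Ω : Type} [MeasureSpace Ω] (hP : IsProbabilityMeasure (ℙ : Measure Ω))
    (X₁ X₂ : Ω → EuclideanSpace ℝ (Fin n))
    (hX₁ : Measurable X₁) (hX₂ : Measurable X₂)
    (hIndep : ProbabilityTheory.IndepFun X₁ X₂ (ℙ : Measure Ω))
    (A₁ A₂ : Set (EuclideanSpace ℝ (Fin n)))
    (hA₁c : IsCompact A₁) (hA₁conv : Convex ℝ A₁) (hA₁int : (interior A₁).Nonempty)
    (hA₂c : IsCompact A₂) (hA₂conv : Convex ℝ A₂) (hA₂int : (interior A₂).Nonempty)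
    (hunif₁ : Measure.map X₁ (ℙ : Measure Ω) = (volume A₁)⁻¹ • volume.restrict A₁)
    (hunif₂ : Measure.map X₂ (ℙ : Measure Ω) = (volume A₂)⁻¹ • volume.restrict A₂) :
    Real.log ((volume (A₁ + A₂)).toReal) - n * Real.log 2
      ≤ dEnt (Measure.map (fun ω => X₁ ω + X₂ ω) (ℙ : Measure Ω)) := by
  have hA₁m := hA₁c.measurableSet
  have hA₂m := hA₂c.measurableSet
  have v1t : volume A₁ ≠ ⊤ := hA₁c.measure_lt_top.ne
  have v2t : volume A₂ ≠ ⊤ := hA₂c.measure_lt_top.ne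
  have v10 : volume A₁ ≠ 0 := (Measure.measure_pos_of_nonempty_interior _ hA₁int).ne'
  have v20 : volume A₂ ≠ 0 := (Measure.measure_pos_of_nonempty_interior _ hA₂int).ne'
  set c₁ := (volume A₁)⁻¹ with hc₁
  set c₂ := (volume A₂)⁻¹ with hc₂
  have c1t : c₁ ≠ ⊤ := by simpa [hc₁] using v10
  have c2t : c₂ ≠ ⊤ := by simpa [hc₂] using v20
  set D : EuclideanSpace ℝ (Fin n) → Set (EuclideanSpace ℝ (Fin n)) :=
    fun z => A₁ ∩ {y | -y + z ∈ A₂} with hD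
  have hDm : ∀ z, MeasurableSet (D z) := fun z => hA₁m.inter
    (hA₂m.preimage (f := fun y => -y + z) (by fun_prop))
  have hDt : ∀ z, volume (D z) ≠ ⊤ := fun z =>
    ne_top_of_le_ne_top v1t (measure_mono Set.inter_subset_left)
  set g : EuclideanSpace ℝ (Fin n) → ENNReal := fun z => c₁ * c₂ * volume (D z) with hg
  have hgconv : lconvolution (A₁.indicator fun _ => c₁) (A₂.indicator fun _ => c₂) volume = g := by
    funext z
    rw [lconvolution_def]
    have e : ∀ y, A₁.indicator (fun _ => c₁) y * A₂.indicator (fun _ => c₂) (-y + z)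
        = (D z).indicator (fun _ => c₁ * c₂) y := by
      intro y
      by_cases h1 : y ∈ A₁ <;> by_cases h2 : -y + z ∈ A₂ <;> simp [hD, h1, h2]
    simp_rw [e]
    rw [lintegral_indicator (hDm z), setLIntegral_const]
  have hgm : Measurable g := by
    rw [← hgconv]
    exact measurable_lconvolution volume (measurable_const.indicator hA₁m)
      (measurable_const.indicator hA₂m)
  have hlaw : Measure.map (fun ω => X₁ ω + X₂ ω) (ℙ : Measure Ω) = volume.withDensity g := by
    have h := hIndep.map_add_eq_map_conv_map hX₁ hX₂
    rw [hunif₁, hunif₂, uniform_eq_withDensity hA₁m, uniform_eq_withDensity hA₂m,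
      conv_withDensity_eq_lconvolution (measurable_const.indicator hA₁m)
      (measurable_const.indicator hA₂m), hgconv] at h
    exact h
  have hgt : ∀ z, g z ≠ ⊤ := fun z => ENNReal.mul_ne_top (ENNReal.mul_ne_top c1t c2t) (hDt z)
  have hg1 : ∫⁻ z, g z = 1 := by
    have hp : IsProbabilityMeasure (Measure.map (fun ω => X₁ ω + X₂ ω) (ℙ : Measure Ω)) :=
      Measure.isProbabilityMeasure_map (hX₁.add hX₂).aemeasurable
    have := hp.measure_univ
    rw [hlaw, withDensity_apply _ MeasurableSet.univ, Measure.restrict_univ] at this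
    exact this
  have hKc : IsCompact (A₁ + A₂) := hA₁c.add hA₂c
  have hKt : volume (A₁ + A₂) ≠ ⊤ := hKc.measure_lt_top.ne
  have hK0 : volume (A₁ + A₂) ≠ 0 := by
    obtain ⟨b, hb⟩ := hA₂int
    have hsub : (fun x => x + b) '' A₁ ⊆ A₁ + A₂ := by
      rintro _ ⟨x, hx, rfl⟩
      exact Set.add_mem_add hx (interior_subset hb)
    have := measure_mono (μ := volume) hsub
    rw [Set.image_add_right, measure_preimage_add_right] at this
    exact fun h => v10 (le_antisymm (h ▸ this) bot_le)
  have hKpos := ENNReal.toReal_pos hK0 hKt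
  set k := (volume (A₁ + A₂)).toReal ^ (1 / n : ℝ) with hk
  have hkpos : 0 < k := by positivity
  have hn0 : (n : ℝ) ≠ 0 := by positivity
  have hkn : k ^ n = (volume (A₁ + A₂)).toReal := by
    rw [hk, ← Real.rpow_natCast, ← Real.rpow_mul hKpos.le]; field_simp; simp
  have hmain := core hn (f := fun z => (g z).toReal) hgm.ennreal_toReal
    (fun z => ENNReal.toReal_nonneg) (M := (c₁ * c₂ * volume A₁).toReal)
    (fun z => ENNReal.toReal_mono (ENNReal.mul_ne_top (ENNReal.mul_ne_top c1t c2t) v1t)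
      (mul_le_mul_right (measure_mono Set.inter_subset_left) _))
    (K := A₁ + A₂) hKc.measurableSet hkpos (by rw [hkn, ENNReal.ofReal_toReal hKt])
    (by
      intro z hz
      have : D z = ∅ := by
        ext y
        simp only [hD, Set.mem_inter_iff, Set.mem_ofPred_eq, Set.mem_empty_iff_false, iff_false]
        rintro ⟨h1, h2⟩
        apply hz
        have := Set.add_mem_add h1 h2
        simpa using this
      simp [hg, this])
    (by simp_rw [ENNReal.ofReal_toReal (hgt _)]; exact hg1)
    (by
      rintro t ht0 ht1 x _ ⟨y₁, hy₁, y₂, hy₂, rfl⟩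
      have hsub : (fun p => p + (1 - t) • y₁) '' (t • D x) ⊆ D (t • x + (1 - t) • (y₁ + y₂)) := by
        rintro _ ⟨_, ⟨p, ⟨hp1, hp2⟩, rfl⟩, rfl⟩
        refine ⟨hA₁conv hp1 hy₁ ht0.le (by linarith) (by ring), ?_⟩
        have h := hA₂conv hp2 hy₂ ht0.le (show 0 ≤ 1 - t by linarith) (by ring)
        simp only [Set.mem_ofPred_eq]
        convert h using 1
        module
      have hv := measure_mono (μ := volume) hsub
      rw [Set.image_add_right, measure_preimage_add_right, Measure.addHaar_smul,
        finrank_euclideanSpace_fin, abs_of_pos (by positivity)] at hv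
      have hle : ENNReal.ofReal (t ^ n) * g x ≤ g (t • x + (1 - t) • (y₁ + y₂)) := by
        simp only [hg]
        calc _ = c₁ * c₂ * (ENNReal.ofReal (t ^ n) * volume (D x)) := by ring
          _ ≤ _ := by gcongr
      have h2 := ENNReal.toReal_mono (hgt _) hle
      rwa [ENNReal.toReal_mul, ENNReal.toReal_ofReal (by positivity)] at h2)
  have hent : dEnt (Measure.map (fun ω => X₁ ω + X₂ ω) (ℙ : Measure Ω))
      = -∫ z, (g z).toReal * Real.log (g z).toReal := by
    rw [dEnt, hlaw]
    congr 1
    refine integral_congr_ae ?_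
    filter_upwards [Measure.rnDeriv_withDensity volume hgm] with z hz
    rw [hz]
  rw [hent, ← hkn, Real.log_pow]
  linarith
end

section
/- There exists a universal constant C > 0 with the following property (Milman's reverse Brunn–Minkowski inequality, recovered from the reverse entropy power inequality): for every dimension n ≥ 1 and all convex bodies A₁, A₂ in ℝⁿ, there exist affine volume-preserving maps u₁, u₂ : ℝⁿ → ℝⁿ such that |u₁(A₁) + u₂(A₂)|^{1/n} ≤ C ( |A₁|^{1/n} + |A₂|^{1/n} ), where + denotes Minkowski sum and |·| denotes Lebesgue volume. -/
open MeasureTheory Real Pointwise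

namespace RBM

section prox
variable {E : Type*} [NormedAddCommGroup E] [InnerProductSpace ℝ E] [FiniteDimensional ℝ E]

/-- limit helper -/
lemma le_of_forall_small {a b c : ℝ} (h : ∀ t : ℝ, 0 < t → t ≤ 1 → a ≤ b + t * c) : a ≤ b := by
  by_contra hab
  push Not at hab
  rcases le_or_gt c 0 with hc | hc
  · have := h 1 one_pos le_rfl
    linarith
  · have h1 := h (min 1 ((a - b) / (2 * c))) (lt_min one_pos (by apply div_pos <;> linarith))
      (min_le_left _ _)
    have h2 : min 1 ((a - b) / (2 * c)) * c ≤ (a - b) / (2 * c) * c :=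
      mul_le_mul_of_nonneg_right (min_le_right _ _) hc.le
    have h3 : (a - b) / (2 * c) * c = (a - b) / 2 := by field_simp
    linarith

lemma exists_prox {K : Set E} (hconv : Convex ℝ K) (h0 : K ∈ nhds (0 : E)) (w : E) :
    ∃ y : E, ∀ u : E, (1/2) * gauge K y ^ 2 + inner ℝ (w - y) (u - y) ≤ (1/2) * gauge K u ^ 2 := by
  have hcont : Continuous (gauge K) := continuous_gauge hconv h0
  have habs : Absorbent ℝ K := absorbent_nhds_zero h0
  have hc : Continuous (fun y : E => (1/2) * gauge K y ^ 2 + (1/2) * ‖y - w‖ ^ 2) := by fun_prop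
  obtain ⟨y, hy, hmin⟩ := (isCompact_closedBall w ‖w‖).exists_isMinOn
    ⟨w, Metric.mem_closedBall_self (norm_nonneg w)⟩ hc.continuousOn
  have hmin' : ∀ u, (1/2) * gauge K y ^ 2 + (1/2) * ‖y - w‖ ^ 2
      ≤ (1/2) * gauge K u ^ 2 + (1/2) * ‖u - w‖ ^ 2 := by
    intro u
    by_cases hu : u ∈ Metric.closedBall w ‖w‖
    · exact hmin hu
    · have h1 : (1/2) * gauge K y ^ 2 + (1/2) * ‖y - w‖ ^ 2
        ≤ (1/2) * gauge K 0 ^ 2 + (1/2) * ‖(0:E) - w‖ ^ 2 :=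
        hmin (by simp)
      rw [gauge_zero] at h1
      simp only [Metric.mem_closedBall, not_le, dist_eq_norm] at hu
      have h2 : ‖(0:E) - w‖ = ‖w‖ := by simp
      rw [h2] at h1
      have : ‖w‖ ^ 2 ≤ ‖u - w‖ ^ 2 := by gcongr
      nlinarith [sq_nonneg (gauge K u)]
  refine ⟨y, fun u => ?_⟩
  have key : ∀ t : ℝ, 0 < t → t ≤ 1 →
      (1/2) * gauge K y ^ 2 + inner ℝ (w - y) (u - y) ≤ (1/2) * gauge K u ^ 2
        + t * ((1/2) * ‖u - y‖ ^ 2) := by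
    intro t ht ht1
    have h1 := hmin' (y + t • (u - y))
    have h2 : gauge K (y + t • (u - y)) ≤ (1 - t) * gauge K y + t * gauge K u := by
      have : y + t • (u - y) = (1 - t) • y + t • u := by module
      rw [this]
      refine (gauge_add_le hconv habs _ _).trans ?_
      rw [gauge_smul_of_nonneg (by linarith), gauge_smul_of_nonneg ht.le]
      simp
    have h3 : gauge K (y + t • (u - y)) ^ 2 ≤ (1 - t) * gauge K y ^ 2 + t * gauge K u ^ 2 := by
      have := gauge_nonneg (s := K) (y + t • (u - y))
      have h4 : gauge K (y + t • (u - y)) ^ 2 ≤ ((1 - t) * gauge K y + t * gauge K u) ^ 2 := by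
        gcongr
      nlinarith [mul_nonneg (mul_nonneg ht.le (sub_nonneg.2 ht1)) (sq_nonneg (gauge K y - gauge K u))]
    have h5 : ‖y + t • (u - y) - w‖ ^ 2 = ‖y - w‖ ^ 2 - 2 * t * inner ℝ (w - y) (u - y)
        + t ^ 2 * ‖u - y‖ ^ 2 := by
      have : y + t • (u - y) - w = t • (u - y) - (w - y) := by module
      rw [this, norm_sub_sq_real, norm_smul, inner_smul_left, real_inner_comm, norm_sub_rev w y,
        mul_pow]
      simp
      ring
    rw [h5] at h1
    have h6 : t * ((1/2) * gauge K y ^ 2 + inner ℝ (w - y) (u - y)) ≤ t * ((1/2) * gauge K u ^ 2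
        + t * ((1/2) * ‖u - y‖ ^ 2)) := by nlinarith
    exact le_of_mul_le_mul_left h6 ht
  exact le_of_forall_small key

/-- The Cayley transform of the subdifferential of `gauge² / 2`. -/
lemma exists_cayley {K : Set E} (hconv : Convex ℝ K) (h0 : K ∈ nhds (0 : E)) :
    ∃ f : E → E, LipschitzWith 1 f ∧ ∀ a : E,
      gauge K (a + f a) ^ 2 ≤ ‖a‖ ^ 2 - ‖f a‖ ^ 2 ∧
      ∀ u ∈ K, inner ℝ (a - f a) u ≤ gauge K (a + f a) := by
  choose P hP using fun w : E => exists_prox hconv h0 w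
  refine ⟨fun a => P ((2:ℝ) • a) - a, ?_, ?_⟩
  · refine LipschitzWith.of_dist_le_mul fun a b => ?_
    simp only [dist_eq_norm, NNReal.coe_one, one_mul]
    set y := P ((2:ℝ) • a)
    set y' := P ((2:ℝ) • b)
    have h1 := hP ((2:ℝ) • a) y'
    have h2 := hP ((2:ℝ) • b) y
    have h3 : inner ℝ ((2:ℝ) • a - y) (y' - y) + inner ℝ ((2:ℝ) • b - y') (y - y') ≤ 0 := by
      linarith
    have h4 : inner ℝ ((2:ℝ) • a - y) (y' - y) + inner ℝ ((2:ℝ) • b - y') (y - y')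
       = ‖y - a - (y' - b)‖ ^ 2 - ‖a - b‖ ^ 2 := by
      have e1 : y - a - (y' - b) = (y - y') - (a - b) := by abel
      rw [e1, norm_sub_sq_real, ← real_inner_self_eq_norm_sq, ← real_inner_self_eq_norm_sq]
      simp only [inner_sub_left, inner_sub_right, inner_smul_left]
      simp only [conj_trivial]
      rw [real_inner_comm y y', real_inner_comm a y, real_inner_comm a y', real_inner_comm b y, real_inner_comm b y']
      ring
    rw [h4] at h3
    exact (sq_le_sq₀ (norm_nonneg _) (norm_nonneg _)).1 (by linarith)
  · intro a
    simp only [add_sub_cancel]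
    set y := P ((2:ℝ) • a)
    have hy := hP ((2:ℝ) • a)
    have hx : a - (y - a) = (2:ℝ) • a - y := by module
    rw [hx]
    set x := (2:ℝ) • a - y with hxdef
    have hnn : 0 ≤ gauge K y := gauge_nonneg _
    have hxy1 : gauge K y ^ 2 ≤ inner ℝ x y := by
      refine le_of_forall_small (c := (1/2) * gauge K y ^ 2) fun t ht ht1 => ?_
      have h1 := hy ((1 - t) • y)
      rw [gauge_smul_of_nonneg (by linarith)] at h1
      have e : (1 - t) • y - y = (-t) • y := by module
      rw [e, inner_smul_right] at h1
      simp only [smul_eq_mul] at h1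
      have : t * gauge K y ^ 2 ≤ t * (inner ℝ x y + t * (1 / 2 * gauge K y ^ 2)) := by nlinarith
      exact le_of_mul_le_mul_left this ht
    have hxy2 : inner ℝ x y ≤ gauge K y ^ 2 := by
      refine le_of_forall_small (c := (1/2) * gauge K y ^ 2) fun t ht ht1 => ?_
      have h1 := hy ((1 + t) • y)
      rw [gauge_smul_of_nonneg (by linarith)] at h1
      have e : (1 + t) • y - y = t • y := by module
      rw [e, inner_smul_right] at h1
      simp only [smul_eq_mul] at h1
      have : t * inner ℝ x y ≤ t * (gauge K y ^ 2 + t * (1 / 2 * gauge K y ^ 2)) := by nlinarith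
      exact le_of_mul_le_mul_left this ht
    constructor
    · have : ‖a‖ ^ 2 - ‖y - a‖ ^ 2 = inner ℝ x y := by
        rw [norm_sub_sq_real, hxdef, inner_sub_left, inner_smul_left, real_inner_self_eq_norm_sq,
          real_inner_comm a y]
        simp
      rw [this]; exact hxy1
    · intro u hu
      by_contra hlt
      push Not at hlt
      set m := inner ℝ x u with hm
      have hm0 : 0 < m := hnn.trans_lt hlt
      have h1 := hy (m • u)
      rw [gauge_smul_of_nonneg hm0.le, inner_sub_right, inner_smul_right, ← hm, smul_eq_mul] at h1
      have h2 : gauge K u ≤ 1 := gauge_le_one_of_mem hu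
      have h3 : (m * gauge K u) ^ 2 ≤ m ^ 2 := by
        rw [mul_pow]
        have : gauge K u ^ 2 ≤ 1 := pow_le_one₀ (gauge_nonneg _) h2
        nlinarith [sq_nonneg m]
      nlinarith
end prox
end RBM

open MeasureTheory Real Pointwise

namespace RBM

section block
variable {E : Type*} [NormedAddCommGroup E] [NormedSpace ℝ E] [FiniteDimensional ℝ E]

/-- the block operator `(u,v) ↦ (u + B v, C u + v)` -/
noncomputable def blk (B C : E →L[ℝ] E) : E × E →L[ℝ] E × E :=
  (ContinuousLinearMap.fst ℝ E E + B.comp (ContinuousLinearMap.snd ℝ E E)).prod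
    (C.comp (ContinuousLinearMap.fst ℝ E E) + ContinuousLinearMap.snd ℝ E E)

lemma det_blk (B C : E →L[ℝ] E) :
    (blk B C).det = LinearMap.det ((1 : E →ₗ[ℝ] E) - (C : E →ₗ[ℝ] E) * (B : E →ₗ[ℝ] E)) := by
  classical
  let b := Module.finBasis ℝ E
  have h1 : LinearMap.toMatrix (b.prod b) (b.prod b) (blk B C : E × E →ₗ[ℝ] E × E)
      = Matrix.fromBlocks 1 (LinearMap.toMatrix b b B) (LinearMap.toMatrix b b C) 1 := by
    ext i j
    rcases i with i | i <;> rcases j with j | j <;>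
      simp [LinearMap.toMatrix_apply, blk, Matrix.one_apply, Finsupp.single_apply, eq_comm]
  rw [ContinuousLinearMap.det, ← LinearMap.det_toMatrix (b.prod b), h1,
    Matrix.det_fromBlocks_one₁₁, ← LinearMap.det_toMatrix b, map_sub, LinearMap.toMatrix_mul]
  simp

end block

section cv
variable {E : Type*} [NormedAddCommGroup E] [InnerProductSpace ℝ E] [FiniteDimensional ℝ E]
  [MeasurableSpace E] [BorelSpace E]

lemma lipschitz_null {F : Type*} [NormedAddCommGroup F] [NormedSpace ℝ F] [FiniteDimensional ℝ F]
    [MeasurableSpace F] [BorelSpace F] (μ : Measure F) [μ.IsAddHaarMeasure]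
    {G : F → F} {k : NNReal} (hG : LipschitzWith k G) {s : Set F} (hs : μ s = 0) :
    μ (G '' s) = 0 := by
  have h1 : μ ≪ Measure.hausdorffMeasure (X := F) (Module.finrank ℝ F) :=
    Measure.absolutelyContinuous_isAddHaarMeasure _ _
  have h2 : Measure.hausdorffMeasure (X := F) (Module.finrank ℝ F) ≪ μ :=
    Measure.absolutelyContinuous_isAddHaarMeasure _ _
  apply h1
  replace hs := h2 hs
  have := hG.hausdorffMeasure_image_le (d := (Module.finrank ℝ F : ℝ)) (by positivity) s
  rw [hs, mul_zero] at this
  exact le_antisymm this (zero_le)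

/-- the shear map -/
def shr (f : E → E) (σ τ : ℝ) (X : E × E) : E × E := (X.1 + σ • f X.2, X.2 + τ • f X.1)

lemma change_of_var {f : E → E} (hf : LipschitzWith 1 f) {σ τ : ℝ} (hσ : |σ| < 1) (hτ : |τ| < 1)
    (g : E × E → ENNReal) :
    ∫⁻ X, g X = ∫⁻ X : E × E, ENNReal.ofReal
      |LinearMap.det ((1 : E →ₗ[ℝ] E) - (σ * τ) • ((fderiv ℝ f X.1 : E →ₗ[ℝ] E) * (fderiv ℝ f X.2 : E →ₗ[ℝ] E)))|
        * g (shr f σ τ X) := by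
  haveI : (volume : Measure (E × E)).IsAddHaarMeasure :=
    inferInstanceAs (((volume : Measure E).prod (volume : Measure E)).IsAddHaarMeasure)
  have hdist : ∀ x y, ‖f x - f y‖ ≤ ‖x - y‖ := fun x y => by
    simpa [dist_eq_norm] using hf.dist_le_mul x y
  have hinj : Function.Injective (shr f σ τ) := by
    rintro ⟨a, b⟩ ⟨a', b'⟩ h
    simp only [shr, Prod.mk.injEq] at h
    obtain ⟨h1, h2⟩ := h
    have e1 : a - a' = -(σ • (f b - f b')) := by
      rw [smul_sub]; rw [← sub_eq_zero] at h1 ⊢; rw [← h1]; abel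
    have e2 : b - b' = -(τ • (f a - f a')) := by
      rw [smul_sub]; rw [← sub_eq_zero] at h2 ⊢; rw [← h2]; abel
    have n1 : ‖a - a'‖ ≤ |σ| * ‖b - b'‖ := by
      rw [e1, norm_neg, norm_smul, Real.norm_eq_abs]
      exact mul_le_mul_of_nonneg_left (hdist _ _) (abs_nonneg _)
    have n2 : ‖b - b'‖ ≤ |τ| * ‖a - a'‖ := by
      rw [e2, norm_neg, norm_smul, Real.norm_eq_abs]
      exact mul_le_mul_of_nonneg_left (hdist _ _) (abs_nonneg _)
    have n3 : ‖b - b'‖ ≤ ‖a - a'‖ := n2.trans (mul_le_of_le_one_left (norm_nonneg _) hτ.le)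
    have n4 : ‖a - a'‖ = 0 := by
      by_contra hne
      have hpos : 0 < ‖a - a'‖ := lt_of_le_of_ne (norm_nonneg _) (Ne.symm hne)
      have : |σ| * ‖b - b'‖ ≤ |σ| * ‖a - a'‖ := mul_le_mul_of_nonneg_left n3 (abs_nonneg _)
      nlinarith
    have n5 : ‖b - b'‖ = 0 := le_antisymm (n3.trans n4.le) (norm_nonneg _)
    rw [norm_eq_zero, sub_eq_zero] at n4 n5
    simp [n4, n5]
  have hsurj : Function.Surjective (shr f σ τ) := by
    rintro ⟨u, v⟩
    have hcon : ContractingWith (⟨|σ|, abs_nonneg _⟩ : NNReal) (fun a => u - σ • f (v - τ • f a)) := by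
      refine ⟨by exact_mod_cast hσ, LipschitzWith.of_dist_le_mul fun a b => ?_⟩
      simp only [dist_eq_norm, NNReal.coe_mk]
      have : u - σ • f (v - τ • f a) - (u - σ • f (v - τ • f b))
        = -(σ • (f (v - τ • f a) - f (v - τ • f b))) := by module
      rw [this, norm_neg, norm_smul, Real.norm_eq_abs]
      refine mul_le_mul_of_nonneg_left ?_ (abs_nonneg _)
      refine (hdist _ _).trans ?_
      have : (v - τ • f a) - (v - τ • f b) = -(τ • (f a - f b)) := by module
      rw [this, norm_neg, norm_smul, Real.norm_eq_abs]
      exact (mul_le_of_le_one_left (norm_nonneg _) hτ.le).trans (hdist _ _)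
    have hfix := hcon.fixedPoint_isFixedPt
    set a := ContractingWith.fixedPoint _ hcon
    refine ⟨(a, v - τ • f a), ?_⟩
    have h1 : u - σ • f (v - τ • f a) = a := hfix
    simp only [shr, sub_add_cancel, Prod.mk.injEq, and_true]
    rw [sub_eq_iff_eq_add] at h1
    exact h1.symm
  have hlip : LipschitzWith 2 (shr f σ τ) := by
    refine LipschitzWith.of_dist_le_mul fun X Y => ?_
    simp only [dist_eq_norm, NNReal.coe_ofNat]
    have hX1 : ‖X.1 - Y.1‖ ≤ ‖X - Y‖ := norm_fst_le (X - Y)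
    have hX2 : ‖X.2 - Y.2‖ ≤ ‖X - Y‖ := norm_snd_le (X - Y)
    refine max_le ?_ ?_
    · have : (shr f σ τ X - shr f σ τ Y).1 = (X.1 - Y.1) + σ • (f X.2 - f Y.2) := by
        simp only [shr, Prod.fst_sub]; module
      rw [this]
      refine (norm_add_le _ _).trans ?_
      rw [norm_smul, Real.norm_eq_abs]
      have := hdist X.2 Y.2
      have : |σ| * ‖f X.2 - f Y.2‖ ≤ 1 * ‖f X.2 - f Y.2‖ := by gcongr
      linarith
    · have : (shr f σ τ X - shr f σ τ Y).2 = (X.2 - Y.2) + τ • (f X.1 - f Y.1) := by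
        simp only [shr, Prod.snd_sub]; module
      rw [this]
      refine (norm_add_le _ _).trans ?_
      rw [norm_smul, Real.norm_eq_abs]
      have := hdist X.1 Y.1
      have : |τ| * ‖f X.1 - f Y.1‖ ≤ 1 * ‖f X.1 - f Y.1‖ := by gcongr
      linarith
  set D : Set E := {x | DifferentiableAt ℝ f x} with hD
  have hDm : MeasurableSet D := measurableSet_of_differentiableAt ℝ f
  have hDae : ∀ᵐ x : E, x ∈ D := hf.ae_differentiableAt
  set Ω : Set (E × E) := D ×ˢ D with hΩ
  have hΩm : MeasurableSet Ω := hDm.prod hDm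
  have hΩnull : (volume : Measure (E × E)) Ωᶜ = 0 := by
    have h1 : ∀ᵐ X : E × E, X.1 ∈ D := Measure.quasiMeasurePreserving_fst.ae hDae
    have h2 : ∀ᵐ X : E × E, X.2 ∈ D := Measure.quasiMeasurePreserving_snd.ae hDae
    have h3 : ∀ᵐ X : E × E, X ∈ Ω := by
      filter_upwards [h1, h2] with X h h' using ⟨h, h'⟩
    exact h3
  have himg : (volume : Measure (E × E)) ((shr f σ τ) '' Ω)ᶜ = 0 := by
    refine measure_mono_null ?_ (lipschitz_null volume hlip hΩnull)
    rw [Set.image_compl_eq ⟨hinj, hsurj⟩]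
  have hder : ∀ X ∈ Ω, HasFDerivWithinAt (shr f σ τ)
      (blk (σ • fderiv ℝ f X.2) (τ • fderiv ℝ f X.1)) Ω X := by
    intro X hX
    have hX1 : HasFDerivAt f (fderiv ℝ f X.1) X.1 := (hX.1 : DifferentiableAt ℝ f X.1).hasFDerivAt
    have hX2 : HasFDerivAt f (fderiv ℝ f X.2) X.2 := (hX.2 : DifferentiableAt ℝ f X.2).hasFDerivAt
    have d1 : HasFDerivAt (fun X : E × E => f X.1) ((fderiv ℝ f X.1).comp (ContinuousLinearMap.fst ℝ E E)) X :=
      hX1.comp X hasFDerivAt_fst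
    have d2 : HasFDerivAt (fun X : E × E => f X.2) ((fderiv ℝ f X.2).comp (ContinuousLinearMap.snd ℝ E E)) X :=
      hX2.comp X hasFDerivAt_snd
    have d3 := (hasFDerivAt_fst.add (d2.const_smul σ)).prodMk ((hasFDerivAt_snd (p := X)).add (d1.const_smul τ))
    refine HasFDerivAt.hasFDerivWithinAt ?_
    refine d3.congr_fderiv ?_
    ext v <;> simp [blk, add_comm]
  have hcv := lintegral_image_eq_lintegral_abs_det_fderiv_mul volume hΩm hder hinj.injOn g
  rw [← setLIntegral_univ g, ← setLIntegral_congr (ae_eq_univ.2 himg), hcv,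
    setLIntegral_congr (ae_eq_univ.2 hΩnull), setLIntegral_univ]
  refine lintegral_congr fun X => ?_
  rw [det_blk]
  congr 5
  ext v
  simp [smul_smul, mul_comm]

end cv
end RBM

open MeasureTheory Real Pointwise

namespace RBM

section hol
lemma hol_integral {α : Type*} [MeasurableSpace α] {μ : Measure α} {U : Set ℂ}
    {h : ℂ → α → ℂ} (hd : ∀ x, Differentiable ℂ (fun s => h s x))
    (hm : ∀ s, AEStronglyMeasurable (h s) μ)
    (hb : ∀ s₀ ∈ U, ∃ δ > 0, ∃ bound : α → ℝ, Integrable bound μ ∧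
      ∀ s ∈ Metric.ball s₀ δ, ∀ x, ‖h s x‖ ≤ bound x) :
    DifferentiableOn ℂ (fun s => ∫ x, h s x ∂μ) U := by
  intro s₀ hs₀
  obtain ⟨δ, hδ, bound, hbi, hbd⟩ := hb s₀ hs₀
  have hder : ∀ s ∈ Metric.ball s₀ (δ / 2), ∀ x, ‖deriv (fun s => h s x) s‖ ≤ bound x / (δ / 4) := by
    intro s hs x
    refine Complex.norm_deriv_le_of_forall_mem_sphere_norm_le (by positivity)
      (hd x).diffContOnCl fun z hz => hbd z ?_ x
    rw [Metric.mem_ball] at hs ⊢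
    rw [Metric.mem_sphere] at hz
    have := dist_triangle z s s₀
    linarith
  have hm' : AEStronglyMeasurable (fun x => deriv (fun s => h s x) s₀) μ := by
    have hu : Filter.Tendsto (fun k : ℕ => (1 / ((k:ℝ) + 1) : ℝ)) Filter.atTop (nhds 0) :=
      tendsto_one_div_add_atTop_nhds_zero_nat
    have hu' : Filter.Tendsto (fun k : ℕ => ((1 / ((k:ℝ) + 1) : ℝ) : ℂ)) Filter.atTop (nhdsWithin 0 {0}ᶜ) := by
      refine tendsto_nhdsWithin_iff.2 ⟨?_, ?_⟩
      · have := (Complex.continuous_ofReal.tendsto 0).comp hu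
        rw [Complex.ofReal_zero] at this
        exact this
      · refine Filter.Eventually.of_forall fun k => ?_
        have : (1 / ((k:ℝ) + 1) : ℝ) ≠ 0 := by positivity
        exact Complex.ofReal_ne_zero.2 this
    refine aestronglyMeasurable_of_tendsto_ae Filter.atTop
      (f := fun (k : ℕ) x => ((1 / ((k:ℝ) + 1) : ℝ) : ℂ)⁻¹ • (h (s₀ + ((1 / ((k:ℝ) + 1) : ℝ) : ℂ)) x - h s₀ x))
      (fun k => ((hm (s₀ + ((1 / ((k:ℝ) + 1) : ℝ) : ℂ))).sub (hm s₀)).const_smul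
        (((1 / ((k:ℝ) + 1) : ℝ) : ℂ)⁻¹)) ?_
    refine Filter.Eventually.of_forall fun x => ?_
    have := (hd x s₀).hasDerivAt.tendsto_slope_zero
    exact this.comp hu'
  have := hasDerivAt_integral_of_dominated_loc_of_deriv_le (μ := μ) (F := h)
    (F' := fun s x => deriv (fun s => h s x) s) (x₀ := s₀) (s := Metric.ball s₀ (δ / 2))
    (bound := fun x => bound x / (δ / 4)) (Metric.ball_mem_nhds s₀ (by positivity))
    (Filter.Eventually.of_forall hm)
    (hbi.mono' (hm s₀) (Filter.Eventually.of_forall fun x => hbd s₀ (Metric.mem_ball_self hδ) x))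
    hm' (Filter.Eventually.of_forall fun x s hs => hder s hs x) (hbi.div_const _)
    (Filter.Eventually.of_forall fun x s _ => (hd x s).hasDerivAt)
  exact this.2.differentiableAt.differentiableWithinAt

end hol

section cdet
variable {E : Type*} [NormedAddCommGroup E] [InnerProductSpace ℝ E] [FiniteDimensional ℝ E]

/-- complexified determinant of `1 + t M`. -/
noncomputable def cd (M : E →L[ℝ] E) (t : ℂ) : ℂ :=
  Matrix.det ((1 : Matrix _ _ ℂ) + t • (LinearMap.toMatrix (stdOrthonormalBasis ℝ E).toBasis
    (stdOrthonormalBasis ℝ E).toBasis (M : E →ₗ[ℝ] E)).map Complex.ofReal)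

lemma cd_real (M : E →L[ℝ] E) (t : ℝ) :
    cd M (t : ℂ) = ((LinearMap.det ((1 : E →ₗ[ℝ] E) + t • (M : E →ₗ[ℝ] E)) : ℝ) : ℂ) := by
  rw [← LinearMap.det_toMatrix (stdOrthonormalBasis ℝ E).toBasis, cd]
  have := RingHom.map_det Complex.ofRealHom (LinearMap.toMatrix (stdOrthonormalBasis ℝ E).toBasis
    (stdOrthonormalBasis ℝ E).toBasis ((1 : E →ₗ[ℝ] E) + t • (M : E →ₗ[ℝ] E)))
  simp only [Complex.ofRealHom_eq_coe] at this
  rw [this]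
  congr 1
  ext i j
  simp [Matrix.one_apply]
  split_ifs <;> simp

lemma cd_diff (M : E →L[ℝ] E) : Differentiable ℂ (cd M) := by
  unfold cd
  simp only [Matrix.det_apply]
  refine Differentiable.fun_sum fun σ _ => ?_
  refine Differentiable.const_smul ?_ _
  refine Differentiable.fun_finsetProd fun i _ => ?_
  simp only [Matrix.add_apply, Matrix.smul_apply, smul_eq_mul]
  fun_prop

lemma cd_cont (t : ℂ) : Continuous (fun M : E →L[ℝ] E => cd M t) := by
  unfold cd
  refine Continuous.matrix_det ?_
  refine continuous_const.add (Continuous.const_smul ?_ t)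
  refine Continuous.matrix_map ?_ Complex.continuous_ofReal
  refine continuous_matrix fun i j => ?_
  simp only [LinearMap.toMatrix_apply, OrthonormalBasis.coe_toBasis_repr_apply,
    OrthonormalBasis.coe_toBasis, OrthonormalBasis.repr_apply_apply, ContinuousLinearMap.coe_coe]
  fun_prop

lemma cd_bound {M : E →L[ℝ] E} (hM : ‖M‖ ≤ 1) {t : ℂ} (ht : ‖t‖ ≤ 1) :
    ‖cd M t‖ ≤ (Module.finrank ℝ E).factorial * 2 ^ (Module.finrank ℝ E) := by
  have := Matrix.det_le (A := ((1 : Matrix _ _ ℂ) + t • (LinearMap.toMatrix (stdOrthonormalBasis ℝ E).toBasis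
    (stdOrthonormalBasis ℝ E).toBasis (M : E →ₗ[ℝ] E)).map Complex.ofReal))
    (abv := IsAbsoluteValue.toAbsoluteValue (norm : ℂ → ℝ)) (x := 2) ?_
  · simpa [cd] using this
  · intro i j
    simp only [IsAbsoluteValue.toAbsoluteValue_apply, Matrix.add_apply, Matrix.smul_apply, Matrix.map_apply,
      LinearMap.toMatrix_apply, OrthonormalBasis.coe_toBasis_repr_apply,
      OrthonormalBasis.coe_toBasis, OrthonormalBasis.repr_apply_apply, ContinuousLinearMap.coe_coe]
    set b := stdOrthonormalBasis ℝ E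
    have h1 : ‖(1 : Matrix _ _ ℂ) i j‖ ≤ 1 := by
      rw [Matrix.one_apply]; split_ifs <;> simp
    have h2 : |inner ℝ (b i) (M (b j))| ≤ 1 := by
      refine (abs_real_inner_le_norm _ _).trans ?_
      have := M.le_opNorm (b j)
      simp only [OrthonormalBasis.norm_eq_one, mul_one, one_mul] at this ⊢
      linarith
    refine (norm_add_le _ _).trans ?_
    have h3 : ‖t • ((inner ℝ (b i) (M (b j)) : ℝ) : ℂ)‖ ≤ 1 := by
      rw [norm_smul, Complex.norm_real, Real.norm_eq_abs]
      exact mul_le_one₀ ht (abs_nonneg _) h2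
    linarith

lemma det_pos {N : E →L[ℝ] E} (hN : ‖N‖ < 1) :
    0 < LinearMap.det ((1 : E →ₗ[ℝ] E) + (N : E →ₗ[ℝ] E)) := by
  have hc : Continuous (fun t : ℝ => LinearMap.det ((1 : E →ₗ[ℝ] E) + t • (N : E →ₗ[ℝ] E))) := by
    have : (fun t : ℝ => LinearMap.det ((1 : E →ₗ[ℝ] E) + t • (N : E →ₗ[ℝ] E))) =
       fun t : ℝ => (cd N (t:ℂ)).re := by
      ext t; rw [cd_real]; simp
    rw [this]
    exact Complex.continuous_re.comp ((cd_diff N).continuous.comp Complex.continuous_ofReal)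
  have hne : ∀ t ∈ Set.Icc (0:ℝ) 1, LinearMap.det ((1 : E →ₗ[ℝ] E) + t • (N : E →ₗ[ℝ] E)) ≠ 0 := by
    intro t ht h0
    have hb := LinearMap.bot_lt_ker_of_det_eq_zero h0
    obtain ⟨v, hv, hv0⟩ := Submodule.exists_mem_ne_zero_of_ne_bot hb.ne'
    have h1 : v + t • N v = 0 := by simpa using hv
    have h2 : ‖v‖ = t * ‖N v‖ := by
      rw [eq_neg_of_add_eq_zero_left h1, norm_neg, norm_smul, Real.norm_of_nonneg ht.1]
      rw [← eq_neg_of_add_eq_zero_left h1]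
    have h3 := N.le_opNorm v
    have h4 : 0 < ‖v‖ := norm_pos_iff.2 hv0
    have h5 : t * ‖N v‖ ≤ 1 * ‖N v‖ := mul_le_mul_of_nonneg_right ht.2 (norm_nonneg _)
    nlinarith
  by_contra hle
  push Not at hle
  have := intermediate_value_Icc' (zero_le_one (α := ℝ)) hc.continuousOn
  have h0 : (0:ℝ) ∈ Set.Icc (LinearMap.det ((1 : E →ₗ[ℝ] E) + (1:ℝ) • (N : E →ₗ[ℝ] E)))
     (LinearMap.det ((1 : E →ₗ[ℝ] E) + (0:ℝ) • (N : E →ₗ[ℝ] E))) := by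
    constructor
    · simpa using hle
    · simp
  obtain ⟨t, ht, h⟩ := this h0
  exact hne t ht h
end cdet
end RBM

open MeasureTheory Real Pointwise

namespace RBM

section main
variable {E : Type*} [NormedAddCommGroup E] [InnerProductSpace ℝ E] [FiniteDimensional ℝ E]
  [MeasurableSpace E] [BorelSpace E]

/-- the composite derivative -/
noncomputable def MM (f : E → E) (X : E × E) : E →L[ℝ] E := (fderiv ℝ f X.1).comp (fderiv ℝ f X.2)

noncomputable def NN (X : E × E) : ℝ := ‖X.1‖ ^ 2 + ‖X.2‖ ^ 2
noncomputable def cc (f : E → E) (X : E × E) : ℝ := inner ℝ X.1 (f X.2) - inner ℝ X.2 (f X.1)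
noncomputable def dd (f : E → E) (X : E × E) : ℝ := ‖f X.1‖ ^ 2 + ‖f X.2‖ ^ 2

noncomputable def hh (f : E → E) (s : ℂ) (X : E × E) : ℂ :=
  Complex.exp (-(NN X : ℂ) - 2 * s * (cc f X : ℂ) - s ^ 2 * (dd f X : ℂ)) * cd (MM f X) (s ^ 2)

variable {f : E → E}

lemma MM_norm (hf : LipschitzWith 1 f) (X : E × E) : ‖MM f X‖ ≤ 1 := by
  have h : ∀ x, ‖fderiv ℝ f x‖ ≤ 1 := fun x => by
    simpa using norm_fderiv_le_of_lipschitz ℝ hf (x₀ := x)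
  refine (ContinuousLinearMap.opNorm_comp_le _ _).trans ?_
  exact mul_le_one₀ (h _) (norm_nonneg _) (h _)

lemma MM_meas (f : E → E) : Measurable (MM f) := by
  have h1 : Measurable (fun X : E × E => fderiv ℝ f X.1) := (measurable_fderiv ℝ f).comp measurable_fst
  have h2 : Measurable (fun X : E × E => fderiv ℝ f X.2) := (measurable_fderiv ℝ f).comp measurable_snd
  have h3 : Continuous (fun p : (E →L[ℝ] E) × (E →L[ℝ] E) => p.1.comp p.2) :=
    continuous_fst.clm_comp continuous_snd
  have := h3.measurable.comp (h1.prodMk h2)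
  exact this

lemma hh_meas (hf : LipschitzWith 1 f) (s : ℂ) : Measurable (hh f s) := by
  have hc := hf.continuous
  refine Measurable.mul ?_ ((cd_cont (s ^ 2)).measurable.comp (MM_meas f))
  refine Continuous.measurable ?_
  unfold NN cc dd
  fun_prop

lemma hh_diff (X : E × E) : Differentiable ℂ (fun s => hh f s X) := by
  unfold hh
  refine Differentiable.mul (by fun_prop) ((cd_diff _).comp (by fun_prop))

lemma NN_nonneg (X : E × E) : 0 ≤ NN X := by unfold NN; positivity

lemma f_le (hf : LipschitzWith 1 f) (hf0 : f 0 = 0) (x : E) : ‖f x‖ ≤ ‖x‖ := by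
  simpa [hf0, dist_eq_norm] using hf.dist_le_mul x 0

lemma dd_le (hf : LipschitzWith 1 f) (hf0 : f 0 = 0) (X : E × E) : dd f X ≤ NN X := by
  unfold NN dd
  have := f_le hf hf0 X.1
  have := f_le hf hf0 X.2
  gcongr

lemma cc_le (hf : LipschitzWith 1 f) (hf0 : f 0 = 0) (X : E × E) : |cc f X| ≤ NN X := by
  unfold NN cc
  refine (abs_sub _ _).trans ?_
  have h1 := f_le hf hf0 X.1
  have h2 := f_le hf hf0 X.2
  have h3 := abs_real_inner_le_norm X.1 (f X.2)
  have h4 := abs_real_inner_le_norm X.2 (f X.1)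
  nlinarith [norm_nonneg X.1, norm_nonneg X.2, sq_nonneg (‖X.1‖ - ‖X.2‖)]

lemma hh_norm (s : ℂ) (X : E × E) : ‖hh f s X‖ =
    Real.exp (-NN X - 2 * s.re * cc f X - (s.re ^ 2 - s.im ^ 2) * dd f X) * ‖cd (MM f X) (s ^ 2)‖ := by
  rw [hh, norm_mul, Complex.norm_exp]
  congr 2
  simp [sq]

lemma hh_bound (hf : LipschitzWith 1 f) (hf0 : f 0 = 0) {s : ℂ} (X : E × E) {ε : ℝ}
    (hs : ε ≤ 1 - 2 * |s.re| - |s.im|) (hε : 0 < ε) :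
    ‖hh f s X‖ ≤ Real.exp (-ε * NN X) *
      ((Module.finrank ℝ E).factorial * 2 ^ (Module.finrank ℝ E)) := by
  have hr := abs_nonneg s.re
  have hi := abs_nonneg s.im
  rw [hh_norm]
  gcongr
  · have h1 := dd_le hf hf0 X
    have h2 := cc_le hf hf0 X
    have h3 : 0 ≤ dd f X := by unfold dd; positivity
    have h4 := NN_nonneg X
    have h5 : -(s.re * cc f X) ≤ |s.re| * NN X := by
      refine (neg_le_abs _).trans ?_
      rw [abs_mul]; gcongr
    have h6 : s.im ^ 2 ≤ |s.im| := by
      rw [← sq_abs]; nlinarith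
    have h7 : s.im ^ 2 * dd f X ≤ |s.im| * NN X := by gcongr
    nlinarith [sq_nonneg s.re, mul_nonneg (sq_nonneg s.re) h3]
  · refine cd_bound (MM_norm hf X) ?_
    rw [norm_pow]
    have := Complex.norm_le_abs_re_add_abs_im s
    refine pow_le_one₀ (norm_nonneg _) (by linarith)

lemma gauss_int {ε : ℝ} (hε : 0 < ε) : Integrable (fun X : E × E => Real.exp (-ε * NN X)) := by
  have h1 : Integrable (fun x : E => Real.exp (-ε * ‖x‖ ^ 2)) := by
    have := (GaussianFourier.integrable_cexp_neg_mul_sq_norm_add (V := E) (b := ε) (by simpa using hε) 0 0).norm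
    refine this.congr (Filter.Eventually.of_forall fun x => ?_)
    simp only [Complex.norm_exp]
    congr 1
    simp [← Complex.ofReal_pow]
  have := h1.mul_prod h1
  refine this.congr (Filter.Eventually.of_forall fun X => ?_)
  simp only [NN]
  rw [← Real.exp_add]; congr 1; ring

lemma gauss_val : ∫ X : E × E, Real.exp (-NN X) = π ^ (Module.finrank ℝ E) := by
  have h1 : ∀ X : E × E, Real.exp (-NN X) = Real.exp (-1 * ‖X.1‖ ^ 2) * Real.exp (-1 * ‖X.2‖ ^ 2) := by
    intro X; rw [← Real.exp_add, NN]; congr 1; ring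
  simp_rw [h1]
  have h2 := integral_prod_mul (μ := (volume : Measure E)) (ν := (volume : Measure E))
    (fun x : E => Real.exp (-1 * ‖x‖ ^ 2)) (fun x : E => Real.exp (-1 * ‖x‖ ^ 2))
  refine h2.trans ?_
  rw [GaussianFourier.integral_rexp_neg_mul_sq_norm one_pos, ← Real.rpow_add (by positivity)]
  rw [add_halves, Real.rpow_natCast, div_one]

lemma hh_real (hf : LipschitzWith 1 f) {s : ℝ} (hs : |s| < 1) :
    ∫ X, hh f (s : ℂ) X = ((π ^ (Module.finrank ℝ E) : ℝ) : ℂ) := by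
  have hdet : ∀ X, 0 < LinearMap.det ((1 : E →ₗ[ℝ] E) + (s ^ 2) • (MM f X : E →ₗ[ℝ] E)) := by
    intro X
    have : ‖s ^ 2 • MM f X‖ < 1 := by
      rw [norm_smul, norm_pow, Real.norm_eq_abs]
      have h1 := MM_norm hf X
      have h2 : |s| ^ 2 < 1 := pow_lt_one₀ (abs_nonneg _) hs (by norm_num)
      nlinarith [sq_nonneg (|s|), norm_nonneg (MM f X)]
    simpa using det_pos this
  have hq : ∀ X, -NN (shr f s (-s) X) = -NN X - 2 * s * cc f X - s ^ 2 * dd f X := by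
    intro X
    simp only [NN, shr, cc, dd]
    rw [norm_add_sq_real, norm_add_sq_real, norm_smul, norm_smul, inner_smul_right, inner_smul_right,
      mul_pow, mul_pow]
    simp only [Real.norm_eq_abs, sq_abs]
    ring
  have hreal : ∀ X, hh f (s : ℂ) X = ((|LinearMap.det ((1 : E →ₗ[ℝ] E) + (s ^ 2) • (MM f X : E →ₗ[ℝ] E))|
      * Real.exp (-NN (shr f s (-s) X)) : ℝ) : ℂ) := by
    intro X
    rw [hh, abs_of_pos (hdet X), hq, mul_comm, ← Complex.ofReal_pow, cd_real]
    push_cast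
    ring_nf
  simp_rw [hreal]
  rw [integral_complex_ofReal]
  congr 1
  have hmeas : Measurable fun X => |LinearMap.det ((1 : E →ₗ[ℝ] E) + (s ^ 2) • (MM f X : E →ₗ[ℝ] E))|
      * Real.exp (-NN (shr f s (-s) X)) := by
    have := Complex.measurable_re.comp (hh_meas hf (s : ℂ))
    have e : (fun X => |LinearMap.det ((1 : E →ₗ[ℝ] E) + (s ^ 2) • (MM f X : E →ₗ[ℝ] E))|
      * Real.exp (-NN (shr f s (-s) X))) = Complex.re ∘ hh f (s : ℂ) := by
      ext X
      simp only [Function.comp, hreal, Complex.ofReal_re]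
    rw [e]
    exact this
  rw [integral_eq_lintegral_of_nonneg_ae (Filter.Eventually.of_forall fun X => by positivity)
    hmeas.aestronglyMeasurable]
  have hcv := change_of_var hf hs (τ := -s) (by simpa using hs) (fun X => ENNReal.ofReal (Real.exp (-NN X)))
  have h2 : ∀ X : E × E, ENNReal.ofReal (|LinearMap.det ((1 : E →ₗ[ℝ] E) + (s ^ 2) • (MM f X : E →ₗ[ℝ] E))|
      * Real.exp (-NN (shr f s (-s) X))) = ENNReal.ofReal
      |LinearMap.det ((1 : E →ₗ[ℝ] E) - (s * -s) • ((fderiv ℝ f X.1 : E →ₗ[ℝ] E) * (fderiv ℝ f X.2 : E →ₗ[ℝ] E)))|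
        * ENNReal.ofReal (Real.exp (-NN (shr f s (-s) X))) := by
    intro X
    rw [ENNReal.ofReal_mul (abs_nonneg _)]
    congr 4
    rw [mul_neg, neg_smul, sub_neg_eq_add, ← sq]
    rfl
  simp_rw [h2]
  rw [← hcv, ← gauss_val (E := E), integral_eq_lintegral_of_nonneg_ae
    (Filter.Eventually.of_forall fun X => by positivity)]
  have : Continuous fun X : E × E => Real.exp (-NN X) := by unfold NN; fun_prop
  exact this.aestronglyMeasurable

lemma contour (hf : LipschitzWith 1 f) (hf0 : f 0 = 0) {κ : ℝ} (hκ0 : 0 ≤ κ) (hκ : κ < 1) :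
    ∫ X, hh f ((κ : ℂ) * Complex.I) X = ((π ^ (Module.finrank ℝ E) : ℝ) : ℂ) := by
  set U : Set ℂ := {s | 2 * |s.re| + |s.im| < 1} with hU
  have hUo : IsOpen U := isOpen_lt (by fun_prop) continuous_const
  have hUc : Convex ℝ U := by
    intro x hx y hy a b ha hb hab
    simp only [hU, Set.mem_ofPred_eq] at hx hy ⊢
    simp only [Complex.add_re, Complex.real_smul, Complex.mul_re, Complex.ofReal_re, Complex.ofReal_im,
      zero_mul, sub_zero, Complex.add_im, Complex.mul_im, add_zero]
    have e1 := abs_add_le (a * x.re) (b * y.re)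
    have e2 := abs_add_le (a * x.im) (b * y.im)
    rw [abs_mul, abs_mul, abs_of_nonneg ha, abs_of_nonneg hb] at e1 e2
    rcases ha.eq_or_lt with rfl | ha'
    · have : b = 1 := by linarith
      subst this; linarith
    · have h1 := mul_lt_mul_of_pos_left hx ha'
      have h2 := mul_le_mul_of_nonneg_left hy.le hb
      linarith
  have hhol : DifferentiableOn ℂ (fun s => ∫ X, hh f s X) U := by
    refine hol_integral (fun X => hh_diff X) (fun s => (hh_meas hf s).aestronglyMeasurable) ?_
    intro s₀ hs₀
    simp only [hU, Set.mem_ofPred_eq] at hs₀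
    set ε := 1 - 2 * |s₀.re| - |s₀.im| with hε
    have hεp : 0 < ε := by linarith
    refine ⟨ε / 6, by positivity, fun X => Real.exp (-(ε / 2) * NN X) *
      ((Module.finrank ℝ E).factorial * 2 ^ (Module.finrank ℝ E)), ?_, ?_⟩
    · exact (gauss_int (by positivity)).mul_const _
    · intro s hs X
      refine hh_bound hf hf0 X ?_ (by positivity)
      rw [Metric.mem_ball, dist_eq_norm] at hs
      have h1 := Complex.abs_re_le_norm (s - s₀)
      have h2 := Complex.abs_im_le_norm (s - s₀)
      have h3 : |s.re| ≤ |s₀.re| + |(s - s₀).re| := by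
        have := abs_add_le s₀.re (s - s₀).re; simpa using this
      have h4 : |s.im| ≤ |s₀.im| + |(s - s₀).im| := by
        have := abs_add_le s₀.im (s - s₀).im; simpa using this
      linarith
  have han : AnalyticOnNhd ℂ (fun s => ∫ X, hh f s X) U := hhol.analyticOnNhd hUo
  have h0 : (0:ℂ) ∈ U := by simp [hU]
  have hk : (κ : ℂ) * Complex.I ∈ U := by
    simp only [hU, Set.mem_ofPred_eq]; simp [abs_of_nonneg hκ0, hκ]
  refine han.eqOn_of_preconnected_of_frequently_eq
    (g := fun _ => ((π ^ (Module.finrank ℝ E) : ℝ) : ℂ)) analyticOnNhd_const hUc.isPreconnected h0 ?_ hk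
  have hu : Filter.Tendsto (fun k : ℕ => (1 / ((k:ℝ) + 1) : ℝ)) Filter.atTop (nhds 0) :=
    tendsto_one_div_add_atTop_nhds_zero_nat
  have hu' : Filter.Tendsto (fun k : ℕ => ((1 / ((k:ℝ) + 1) : ℝ) : ℂ)) Filter.atTop (nhdsWithin 0 {0}ᶜ) := by
    refine tendsto_nhdsWithin_iff.2 ⟨?_, ?_⟩
    · have := (Complex.continuous_ofReal.tendsto 0).comp hu
      rw [Complex.ofReal_zero] at this
      exact this
    · refine Filter.Eventually.of_forall fun k => ?_
      have : (1 / ((k:ℝ) + 1) : ℝ) ≠ 0 := by positivity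
      exact Complex.ofReal_ne_zero.2 this
  refine hu'.frequently (Filter.Eventually.frequently ?_)
  have : ∀ᶠ k : ℕ in Filter.atTop, (1 / ((k:ℝ) + 1) : ℝ) < 1 := hu.eventually_lt_const one_pos
  filter_upwards [this] with k hk
  refine hh_real hf ?_
  rwa [abs_of_nonneg (by positivity)]

/-- The key lower bound. -/
lemma key_lower (hf : LipschitzWith 1 f) (hf0 : f 0 = 0) {κ : ℝ} (hκ0 : 0 ≤ κ) (hκ : κ < 1) :
    ENNReal.ofReal (π ^ (Module.finrank ℝ E)) ≤ ∫⁻ X : E × E, ENNReal.ofReal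
      |LinearMap.det ((1 : E →ₗ[ℝ] E) - (κ * κ) • ((fderiv ℝ f X.1 : E →ₗ[ℝ] E) * (fderiv ℝ f X.2 : E →ₗ[ℝ] E)))|
        * ENNReal.ofReal (Real.exp (-(NN X - dd f X))) := by
  have h1 := contour hf hf0 hκ0 hκ
  have h2 : ENNReal.ofReal (π ^ (Module.finrank ℝ E)) = ‖∫ X, hh f ((κ : ℂ) * Complex.I) X‖ₑ := by
    rw [h1, ← ofReal_norm, Complex.norm_real, Real.norm_of_nonneg (by positivity)]
  rw [h2]
  refine (enorm_integral_le_lintegral_enorm _).trans (lintegral_mono fun X => ?_)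
  rw [← ofReal_norm, hh_norm, mul_comm, ENNReal.ofReal_mul (norm_nonneg _)]
  have e : ((κ:ℂ) * Complex.I) ^ 2 = ((-(κ * κ) : ℝ) : ℂ) := by
    rw [mul_pow, Complex.I_sq]; push_cast; ring
  gcongr
  · apply le_of_eq
    rw [e, cd_real, Complex.norm_real, Real.norm_eq_abs, neg_smul, ← sub_eq_add_neg]
    rfl
  · have h3 : 0 ≤ dd f X := by unfold dd; positivity
    simp
    exact mul_le_of_le_one_left h3 (pow_le_one₀ hκ0 hκ.le)
end main
end RBM

open MeasureTheory Real Pointwise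

namespace RBM

section main
variable {E : Type*} [NormedAddCommGroup E] [InnerProductSpace ℝ E] [FiniteDimensional ℝ E]

/-- symmetric convex bodies -/
structure SymBody (K : Set E) : Prop where
  cpt : IsCompact K
  conv : Convex ℝ K
  nhds : K ∈ nhds (0 : E)
  symm : ∀ x ∈ K, -x ∈ K

def pol (K : Set E) : Set E := {x | ∀ u ∈ K, inner ℝ x u ≤ 1}

lemma SymBody.abs {K : Set E} (hK : SymBody K) : Absorbent ℝ K := absorbent_nhds_zero hK.nhds

lemma SymBody.zero {K : Set E} (hK : SymBody K) : (0 : E) ∈ K := mem_of_mem_nhds hK.nhds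

lemma SymBody.polar {K : Set E} (hK : SymBody K) : SymBody (pol K) := by
  obtain ⟨r, hr, hrK⟩ := Metric.mem_nhds_iff.1 hK.nhds
  obtain ⟨R, hR⟩ := hK.cpt.isBounded.subset_closedBall (0 : E)
  refine ⟨?_, ?_, ?_, ?_⟩
  · refine Metric.isCompact_of_isClosed_isBounded ?_ ?_
    · have : pol K = ⋂ u ∈ K, {x : E | inner ℝ x u ≤ 1} := by ext x; simp [pol]
      rw [this]
      exact isClosed_biInter fun u _ => isClosed_le (by fun_prop) continuous_const
    · refine (Metric.isBounded_closedBall (x := (0:E)) (r := 2 / r)).subset fun x hx => ?_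
      rw [mem_closedBall_zero_iff]
      by_cases h0 : x = 0
      · subst h0; simp; positivity
      have hn : 0 < ‖x‖ := norm_pos_iff.2 h0
      have hm : (r / 2 / ‖x‖) • x ∈ K := by
        apply hrK
        rw [mem_ball_zero_iff, norm_smul, Real.norm_of_nonneg (by positivity)]
        rw [div_mul_cancel₀ _ hn.ne']
        linarith
      have := hx _ hm
      rw [inner_smul_right, real_inner_self_eq_norm_sq] at this
      have e : r / 2 / ‖x‖ * ‖x‖ ^ 2 = r / 2 * ‖x‖ := by field_simp
      rw [e] at this
      rw [le_div_iff₀ hr]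
      linarith
  · intro x hx y hy a b ha hb hab u hu
    rw [inner_add_left, real_inner_smul_left, real_inner_smul_left]
    nlinarith [hx u hu, hy u hu]
  · have hR0 : 0 < |R| + 1 := by positivity
    refine Metric.mem_nhds_iff.2 ⟨1 / (|R| + 1), by positivity, fun x hx u hu => ?_⟩
    rw [mem_ball_zero_iff, lt_div_iff₀ hR0] at hx
    have h1 := hR hu
    rw [mem_closedBall_zero_iff] at h1
    have h2 : ‖u‖ ≤ |R| + 1 := by linarith [le_abs_self R]
    calc inner ℝ x u ≤ ‖x‖ * ‖u‖ := real_inner_le_norm _ _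
      _ ≤ ‖x‖ * (|R| + 1) := by gcongr
      _ ≤ 1 := hx.le
  · intro x hx u hu
    have := hx _ (hK.symm u hu)
    rw [inner_neg_left]; rwa [inner_neg_right] at this

lemma gauge_pol_le {K : Set E} {x : E} {ρ : ℝ} (hρ : 0 ≤ ρ) (h : ∀ u ∈ K, inner ℝ x u ≤ ρ) :
    gauge (pol K) x ≤ ρ := by
  refine le_of_forall_pos_le_add fun ε hε => ?_
  have hp : 0 < ρ + ε := by linarith
  refine gauge_le_of_mem hp.le ?_
  rw [Set.mem_smul_set_iff_inv_smul_mem₀ hp.ne']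
  intro u hu
  rw [real_inner_smul_left, inv_mul_le_iff₀ hp]
  linarith [h u hu]

lemma gauge_compare {K L : Set E} (hK : SymBody K) (hL : SymBody L) :
    ∃ M : ℝ, 0 ≤ M ∧ ∀ x, gauge K x ≤ M * gauge L x := by
  obtain ⟨r, hr, hrK⟩ := Metric.mem_nhds_iff.1 hK.nhds
  obtain ⟨R, hR⟩ := hL.cpt.isBounded.subset_closedBall (0 : E)
  have hR' : L ⊆ Metric.closedBall 0 (|R| + 1) :=
    hR.trans (Metric.closedBall_subset_closedBall (by linarith [le_abs_self R]))
  have hR0 : 0 < |R| + 1 := by positivity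
  refine ⟨(|R| + 1) / r, by positivity, fun x => ?_⟩
  have h1 := mul_gauge_le_norm (x := x) hrK
  have h2 := le_gauge_of_subset_closedBall (x := x) hL.abs hR0.le hR'
  rw [div_le_iff₀ hR0] at h2
  rw [div_mul_eq_mul_div, le_div_iff₀ hr]
  linarith

lemma gauge_conv {K : Set E} (hK : SymBody K) (x y : E) {s t : ℝ} (hs : 0 ≤ s) (ht : 0 ≤ t) :
    gauge K (s • x + t • y) ≤ s * gauge K x + t * gauge K y := by
  refine (gauge_add_le hK.conv hK.abs _ _).trans ?_
  rw [gauge_smul_of_nonneg hs, gauge_smul_of_nonneg ht]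
  simp

variable [MeasurableSpace E] [BorelSpace E]

lemma gauge_int {K : Set E} (hK : SymBody K) :
    ∫⁻ x : E, ENNReal.ofReal (Real.exp (-(gauge K x ^ 2 / 16))) ≤
      ENNReal.ofReal (4 ^ (Module.finrank ℝ E) * Real.Gamma (Module.finrank ℝ E / 2 + 1)) * volume K := by
  set n := Module.finrank ℝ E with hn
  set g : E → ℝ := fun x => gauge K x / 4 with hg
  have hgc : Continuous g := (continuous_gauge hK.conv hK.nhds).div_const 4
  have key := MeasureTheory.measure_lt_one_eq_integral_div_gamma (volume : Measure E) (g := g)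
    (by simp [hg]) (fun x => by simp only [hg]; rw [gauge_neg hK.symm])
    (fun x y => by
      simp only [hg]
      have := gauge_add_le hK.conv hK.abs x y
      linarith)
    (fun {x} hx => by
      have h0 : gauge K x = 0 := by simpa [hg] using hx
      exact (gauge_eq_zero hK.abs (NormedSpace.isVonNBounded_of_isBounded ℝ hK.cpt.isBounded)).1 h0)
    (fun r x => by
      simp only [hg]
      have : gauge K (r • x) = |r| * gauge K x := by
        rcases le_total 0 r with h | h
        · rw [gauge_smul_of_nonneg h, abs_of_nonneg h]; simp
        · rw [← gauge_neg hK.symm, ← neg_smul, gauge_smul_of_nonneg (neg_nonneg.2 h), abs_of_nonpos h]; simp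
      rw [this, mul_div_assoc])
    (p := 2) (by norm_num)
  have hG : 0 < Real.Gamma ((n:ℝ) / 2 + 1) := Real.Gamma_pos_of_pos (by positivity)
  have hsub : {x : E | g x < 1} ⊆ (4:ℝ) • K := by
    intro x hx
    have hx' : gauge K x / 4 < 1 := hx
    have h1 : gauge K ((4:ℝ)⁻¹ • x) < 1 := by
      rw [gauge_smul_of_nonneg (by norm_num)]; simp; linarith
    rw [Set.mem_smul_set_iff_inv_smul_mem₀ (by norm_num)]
    exact setOfPred_gauge_lt_one_subset_self hK.conv hK.zero hK.abs h1
  have hpos : 0 < volume {x : E | g x < 1} := by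
    refine IsOpen.measure_pos _ (isOpen_lt hgc continuous_const) ⟨0, ?_⟩
    simp [hg]
  have hintg : Integrable (fun x => Real.exp (-(g x) ^ (2:ℝ))) := by
    by_contra hc
    rw [integral_undef hc] at key
    rw [key] at hpos
    simp at hpos
  have e : ∀ x, Real.exp (-(gauge K x ^ 2 / 16)) = Real.exp (-(g x) ^ (2:ℝ)) := by
    intro x
    congr 2
    simp only [hg]
    rw [Real.rpow_two]; ring
  simp_rw [e]
  rw [← ofReal_integral_eq_lintegral_ofReal hintg (Filter.Eventually.of_forall fun x => (Real.exp_pos _).le)]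
  have h2 : ENNReal.ofReal (∫ x, Real.exp (-(g x) ^ (2:ℝ))) =
      ENNReal.ofReal (Real.Gamma ((n:ℝ) / 2 + 1)) * volume {x : E | g x < 1} := by
    rw [key, ← ENNReal.ofReal_mul hG.le, mul_div_cancel₀ _ hG.ne']
  rw [h2]
  calc _ ≤ ENNReal.ofReal (Real.Gamma ((n:ℝ) / 2 + 1)) * volume ((4:ℝ) • K) := by gcongr
    _ = _ := by
      rw [Measure.addHaar_smul, abs_of_pos (by positivity), ← mul_assoc, ← ENNReal.ofReal_mul hG.le, mul_comm (Real.Gamma _)]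

lemma gamma_sq (n : ℕ) : Real.Gamma ((n:ℝ) / 2 + 1) ^ 2 ≤ n.factorial := by
  have h := Real.Gamma_mul_add_mul_le_rpow_Gamma_mul_rpow_Gamma (s := (n:ℝ) + 1) (t := 1) (a := 1/2) (b := 1/2)
    (by positivity) one_pos (by norm_num) (by norm_num) (by norm_num)
  have e : (1/2 : ℝ) * ((n:ℝ) + 1) + 1/2 * 1 = n / 2 + 1 := by ring
  rw [e, Real.Gamma_one, Real.one_rpow, mul_one, Real.Gamma_nat_eq_factorial] at h
  have hG : 0 < Real.Gamma ((n:ℝ) / 2 + 1) := Real.Gamma_pos_of_pos (by positivity)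
  calc _ ≤ ((n.factorial : ℝ) ^ (1/2 : ℝ)) ^ 2 := by gcongr
    _ = n.factorial := by
      rw [← Real.rpow_natCast, ← Real.rpow_mul (by positivity)]; norm_num

lemma lint_smul (F : E → ENNReal) (hF : Measurable F) (v : E) :
    ∫⁻ w : E, F ((2:ℝ) • w - v) = ENNReal.ofReal ((1/2) ^ (Module.finrank ℝ E)) * ∫⁻ w, F w := by
  have h1 : ∫⁻ w : E, F ((2:ℝ) • w - v) = ∫⁻ w, F (w - v) ∂(Measure.map (fun w => (2:ℝ) • w) volume) := by
    rw [lintegral_map (by fun_prop) (by fun_prop)]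
  rw [h1]
  have h2 := Measure.map_addHaar_smul (volume : Measure E) (r := 2) two_ne_zero
  have h3 : Measure.map (fun w : E => (2:ℝ) • w) volume = ENNReal.ofReal ((1/2) ^ (Module.finrank ℝ E)) • (volume : Measure E) := by
    refine h2.trans ?_
    congr 2
    rw [abs_of_pos (by positivity)]; simp
  rw [h3, lintegral_smul_measure, lintegral_sub_right_eq_self]
  rfl

lemma fub (F G : E → ENNReal) (hF : Measurable F) (hG : Measurable G) :
    ∫⁻ X : E × E, F (X.1 + X.2) * G (X.1 - X.2) =
      ENNReal.ofReal ((1/2) ^ (Module.finrank ℝ E)) * ((∫⁻ x, F x) * ∫⁻ x, G x) := by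
  have h1 : ∫⁻ X : E × E, F (X.1 + X.2) * G (X.1 - X.2) = ∫⁻ w : E, ∫⁻ v : E, F (w + v) * G (w - v) := by
    refine lintegral_prod _ ?_
    apply Measurable.aemeasurable
    fun_prop
  have h2 : ∀ w : E, ∫⁻ v : E, F (w + v) * G (w - v) = ∫⁻ v : E, F v * G ((2:ℝ) • w - v) := by
    intro w
    rw [← lintegral_add_left_eq_self (fun v => F v * G ((2:ℝ) • w - v)) w]
    congr 1
    ext v
    congr 2
    rw [two_smul]; abel
  rw [h1]
  simp_rw [h2]
  rw [lintegral_lintegral_swap]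
  · have h3 : ∀ v : E, ∫⁻ w : E, F v * G ((2:ℝ) • w - v) =
      F v * (ENNReal.ofReal ((1/2) ^ (Module.finrank ℝ E)) * ∫⁻ w, G w) := by
      intro v
      rw [lintegral_const_mul _ (by fun_prop), lint_smul G hG]
    simp_rw [h3]
    rw [lintegral_mul_const _ hF]
    ring
  · apply Measurable.aemeasurable
    simp only [Function.uncurry_def]
    fun_prop

/-- Bourgain and Milman. -/
theorem bourgain_milman {K : Set E} (hK : SymBody K) :
    ENNReal.ofReal (π ^ (Module.finrank ℝ E)) ≤
      ENNReal.ofReal (8 ^ (Module.finrank ℝ E) * (Module.finrank ℝ E).factorial) *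
        (volume K * volume (pol K)) := by
  have hP := hK.polar
  obtain ⟨f, hf, hfa⟩ := exists_cayley hK.conv hK.nhds
  have hf0 : f 0 = 0 := by
    have := (hfa 0).1
    have h2 : ‖f 0‖ ^ 2 ≤ 0 := by
      have := this; simp at this; nlinarith [sq_nonneg (gauge K (f 0))]
    exact norm_eq_zero.1 (pow_eq_zero_iff (two_ne_zero) |>.1 (le_antisymm h2 (sq_nonneg _)))
  obtain ⟨M₁, hM₁, hM₁'⟩ := gauge_compare hK hP
  obtain ⟨M₂, hM₂, hM₂'⟩ := gauge_compare hP hK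
  set M := M₁ + M₂ with hM
  have hM0 : 0 ≤ M := by positivity
  set κ := M / (M + 1) with hκd
  have hκ0 : 0 ≤ κ := by positivity
  have hκ : κ < 1 := by rw [hκd, div_lt_one (by positivity)]; linarith
  have hκM : (1 - κ) * M ≤ 1 := by
    have : (1 - κ) * M = κ := by rw [hκd]; field_simp; ring
    linarith
  have hpt : ∀ a, gauge K (a + κ • f a) ≤ 2 * gauge K (a + f a) ∧
      gauge (pol K) (a - κ • f a) ≤ 2 * gauge K (a + f a) := by
    intro a
    set ρ := gauge K (a + f a) with hρ
    have hρ0 : 0 ≤ ρ := gauge_nonneg _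
    have hx : gauge (pol K) (a - f a) ≤ ρ := gauge_pol_le hρ0 (hfa a).2
    have hMρ : (1 - κ) * (M * ρ) ≤ ρ := by
      have := mul_le_mul_of_nonneg_right hκM hρ0
      linarith
    constructor
    · have e : a + κ • f a = ((1 + κ) / 2) • (a + f a) + ((1 - κ) / 2) • (a - f a) := by module
      rw [e]
      refine (gauge_conv hK _ _ (by linarith) (by linarith)).trans ?_
      have h1 : gauge K (a - f a) ≤ M * ρ := by
        refine (hM₁' _).trans ?_
        calc M₁ * gauge (pol K) (a - f a) ≤ M₁ * ρ := by gcongr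
          _ ≤ M * ρ := by gcongr; linarith
      nlinarith
    · have e : a - κ • f a = ((1 + κ) / 2) • (a - f a) + ((1 - κ) / 2) • (a + f a) := by module
      rw [e]
      refine (gauge_conv hP _ _ (by linarith) (by linarith)).trans ?_
      have h1 : gauge (pol K) (a + f a) ≤ M * ρ := by
        refine (hM₂' _).trans ?_
        calc M₂ * gauge K (a + f a) ≤ M₂ * ρ := by gcongr
          _ ≤ M * ρ := by gcongr; linarith
      nlinarith
  set F : E → ENNReal := fun x => ENNReal.ofReal (Real.exp (-(gauge K x ^ 2 / 16))) with hF
  set G : E → ENNReal := fun x => ENNReal.ofReal (Real.exp (-(gauge (pol K) x ^ 2 / 16))) with hG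
  have hgK := continuous_gauge hK.conv hK.nhds
  have hgP := continuous_gauge hP.conv hP.nhds
  have hFm : Measurable F := by
    apply Measurable.ennreal_ofReal; apply Continuous.measurable; fun_prop
  have hGm : Measurable G := by
    apply Measurable.ennreal_ofReal; apply Continuous.measurable; fun_prop
  have hκa : |κ| < 1 := by rwa [abs_of_nonneg hκ0]
  have hcv := change_of_var hf hκa hκa (fun X : E × E => F (X.1 + X.2) * G (X.1 - X.2))
  have hkl := key_lower hf hf0 hκ0 hκ
  have hle : ENNReal.ofReal (π ^ (Module.finrank ℝ E)) ≤ ∫⁻ X : E × E, F (X.1 + X.2) * G (X.1 - X.2) := by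
    rw [hcv]
    refine hkl.trans (lintegral_mono fun X => ?_)
    gcongr
    simp only [hF, hG, shr]
    rw [← ENNReal.ofReal_mul (Real.exp_pos _).le, ← Real.exp_add]
    apply ENNReal.ofReal_le_ofReal
    rw [Real.exp_le_exp]
    obtain ⟨a, b⟩ := X
    simp only [NN, dd]
    have e1 : a + κ • f b + (b + κ • f a) = (a + κ • f a) + (b + κ • f b) := by abel
    have e2 : a + κ • f b - (b + κ • f a) = (a - κ • f a) + -(b - κ • f b) := by abel
    rw [e1, e2]
    have h1 := gauge_add_le hK.conv hK.abs (a + κ • f a) (b + κ • f b)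
    have h2 := gauge_add_le hP.conv hP.abs (a - κ • f a) (-(b - κ • f b))
    rw [gauge_neg hP.symm] at h2
    have p1 := gauge_nonneg (s := K) (a + κ • f a + (b + κ • f b))
    have p2 := gauge_nonneg (s := pol K) (a - κ • f a + -(b - κ • f b))
    obtain ⟨ha1, ha2⟩ := hpt a
    obtain ⟨hb1, hb2⟩ := hpt b
    have ha := (hfa a).1
    have hb := (hfa b).1
    set A := gauge K (a + f a)
    set B := gauge K (b + f b)
    have q1 : gauge K (a + κ • f a + (b + κ • f b)) ^ 2 ≤ (2 * A + 2 * B) ^ 2 :=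
      pow_le_pow_left₀ p1 (by linarith) 2
    have q2 : gauge (pol K) (a - κ • f a + -(b - κ • f b)) ^ 2 ≤ (2 * A + 2 * B) ^ 2 :=
      pow_le_pow_left₀ p2 (by linarith) 2
    nlinarith [sq_nonneg (A - B)]
  rw [fub F G hFm hGm] at hle
  refine hle.trans ?_
  calc _ ≤ ENNReal.ofReal ((1/2) ^ (Module.finrank ℝ E)) *
      ((ENNReal.ofReal (4 ^ (Module.finrank ℝ E) * Real.Gamma (Module.finrank ℝ E / 2 + 1)) * volume K) *
      (ENNReal.ofReal (4 ^ (Module.finrank ℝ E) * Real.Gamma (Module.finrank ℝ E / 2 + 1)) * volume (pol K))) := by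
        gcongr
        · exact gauge_int hK
        · exact gauge_int hP
    _ = ENNReal.ofReal (8 ^ (Module.finrank ℝ E) * Real.Gamma (Module.finrank ℝ E / 2 + 1) ^ 2) *
        (volume K * volume (pol K)) := by
      set c := 4 ^ (Module.finrank ℝ E) * Real.Gamma (Module.finrank ℝ E / 2 + 1) with hc
      have hGp : 0 < Real.Gamma ((Module.finrank ℝ E : ℝ) / 2 + 1) := Real.Gamma_pos_of_pos (by positivity)
      have hc0 : 0 ≤ c := by positivity
      have : (8:ℝ) ^ (Module.finrank ℝ E) * Real.Gamma (Module.finrank ℝ E / 2 + 1) ^ 2 =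
          (1/2) ^ (Module.finrank ℝ E) * (c * c) := by
        have h8 : (8:ℝ) ^ (Module.finrank ℝ E) = (1/2) ^ (Module.finrank ℝ E) * (4 ^ (Module.finrank ℝ E) * 4 ^ (Module.finrank ℝ E)) := by
          rw [← mul_pow, ← mul_pow]; norm_num
        rw [h8, hc]; ring
      rw [this, ENNReal.ofReal_mul (p := (1/2) ^ (Module.finrank ℝ E)) (q := c * c) (by positivity),
        ENNReal.ofReal_mul (p := c) (q := c) hc0]
      ring
    _ ≤ _ := by
      gcongr
      exact gamma_sq _

end main
end RBM

open MeasureTheory Real Pointwise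

namespace RBM

section main
variable {E : Type*} [NormedAddCommGroup E] [InnerProductSpace ℝ E] [FiniteDimensional ℝ E]
  [MeasurableSpace E] [BorelSpace E]

noncomputable def ZZ (K : Set E) (ξ : E) : ℝ := ∫ x in K, Real.exp (inner ℝ ξ x)
noncomputable def mm (K : Set E) (ξ : E) : E := ∫ x in K, Real.exp (inner ℝ ξ x) • x
noncomputable def bb (K : Set E) (ξ : E) : E := (ZZ K ξ)⁻¹ • mm K ξ

variable {K : Set E}

lemma cint {G : Type*} [NormedAddCommGroup G] (hK : SymBody K) {φ : E → G} (hφ : Continuous φ) :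
    Integrable φ (volume.restrict K) := hφ.continuousOn.integrableOn_compact hK.cpt

lemma cws {G : Type*} [NormedAddCommGroup G] [NormedSpace ℝ G]
    {φ : E → G} (hφ : Continuous φ) (ξ : E) :
    Continuous fun x : E => Real.exp (inner ℝ ξ x) • (innerSL ℝ x).smulRight (φ x) := by
  have he : Continuous fun x : E => Real.exp (inner ℝ ξ x) := by fun_prop
  refine he.smul ?_
  exact ((ContinuousLinearMap.smulRightL ℝ E G).continuous₂).comp
      (Continuous.prodMk (innerSL ℝ).continuous hφ)

lemma deriv_int {G : Type*} [NormedAddCommGroup G] [NormedSpace ℝ G] (hK : SymBody K)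
    [FiniteDimensional ℝ G]
    {φ : E → G} (hφ : Continuous φ) (ξ : E) :
    HasFDerivAt (fun ξ => ∫ x in K, Real.exp (inner ℝ ξ x) • φ x)
      (∫ x in K, Real.exp (inner ℝ ξ x) • (innerSL ℝ x).smulRight (φ x)) ξ := by
  have hc : ∀ ξ : E, Continuous fun x : E => Real.exp (inner ℝ ξ x) • (innerSL ℝ x).smulRight (φ x) := cws hφ
  have hc2 : Continuous fun x : E => Real.exp ((‖ξ‖ + 1) * ‖x‖) * ‖(innerSL ℝ x).smulRight (φ x)‖ := by
    have := (hc 0).norm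
    simp only [inner_zero_left, Real.exp_zero, one_smul] at this
    fun_prop
  refine hasFDerivAt_integral_of_dominated_of_fderiv_le (𝕜 := ℝ)
    (F' := fun ξ x => Real.exp (inner ℝ ξ x) • (innerSL ℝ x).smulRight (φ x))
    (bound := fun x => Real.exp ((‖ξ‖ + 1) * ‖x‖) * ‖(innerSL ℝ x).smulRight (φ x)‖)
    (Metric.ball_mem_nhds ξ one_pos) ?_ ?_ ?_ ?_ ?_ ?_
  · refine Filter.Eventually.of_forall fun η => ?_
    exact (cint hK (by fun_prop)).aestronglyMeasurable
  · exact cint hK (by fun_prop)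
  · exact (cint hK (hc ξ)).aestronglyMeasurable
  · refine Filter.Eventually.of_forall fun x η hη => ?_
    rw [norm_smul, Real.norm_of_nonneg (Real.exp_pos _).le]
    gcongr
    refine (real_inner_le_norm _ _).trans ?_
    gcongr
    rw [mem_ball_iff_norm] at hη
    have := norm_sub_norm_le η ξ
    linarith
  · exact cint hK hc2
  · refine Filter.Eventually.of_forall fun x η hη => ?_
    have h1 : HasFDerivAt (fun η : E => inner ℝ η x) (innerSL ℝ x) η := by
      have := (innerSL ℝ x).hasFDerivAt (x := η)
      refine this.congr_of_eventuallyEq (Filter.Eventually.of_forall fun y => ?_)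
      simp [real_inner_comm]
    have h2 := h1.exp.smul_const (φ x)
    convert h2 using 1
    ext y
    simp [mul_smul]

lemma ZZ_pos (hK : SymBody K) (ξ : E) : 0 < ZZ K ξ := by
  unfold ZZ
  rw [setIntegral_pos_iff_support_of_nonneg_ae]
  · have : Function.support (fun x => Real.exp (inner ℝ ξ x)) = Set.univ := by
      ext x; simp [Real.exp_ne_zero]
    rw [this, Set.univ_inter]
    exact Measure.measure_pos_of_mem_nhds _ hK.nhds
  · exact Filter.Eventually.of_forall fun x => (Real.exp_pos _).le
  · exact cint hK (by fun_prop)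

lemma int_inner (hK : SymBody K) (ξ h : E) :
    ∫ x in K, Real.exp (inner ℝ ξ x) * inner ℝ x h = ZZ K ξ * inner ℝ (bb K ξ) h := by
  have h1 : ∀ x : E, Real.exp (inner ℝ ξ x) * inner ℝ x h = inner ℝ h (Real.exp (inner ℝ ξ x) • x) := by
    intro x; rw [inner_smul_right, real_inner_comm x h]
  simp_rw [h1]
  rw [integral_inner (cint hK (by fun_prop))]
  rw [bb, real_inner_smul_left, mul_inv_cancel_left₀ (ZZ_pos hK ξ).ne', real_inner_comm]
  rfl

lemma bb_deriv (hK : SymBody K) (ξ : E) : ∃ B : E →L[ℝ] E, HasFDerivAt (bb K) B ξ ∧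
    ∀ h k : E, inner ℝ k (B h) = (ZZ K ξ)⁻¹ *
      ∫ x in K, Real.exp (inner ℝ ξ x) * (inner ℝ (x - bb K ξ) h * inner ℝ (x - bb K ξ) k) := by
  have hZ := ZZ_pos hK ξ
  have d1 : HasFDerivAt (ZZ K) (∫ x in K, Real.exp (inner ℝ ξ x) • (innerSL ℝ x).smulRight (1:ℝ)) ξ := by
    have := deriv_int hK (φ := fun _ => (1:ℝ)) continuous_const ξ
    have e : ZZ K = fun ξ => ∫ x in K, Real.exp (inner ℝ ξ x) • (1:ℝ) := by
      ext ξ; simp [ZZ]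
    rw [e]
    exact this
  have d2 := deriv_int hK (φ := fun x : E => x) continuous_id ξ
  have d3 := ((hasDerivAt_inv hZ.ne').comp_hasFDerivAt ξ d1).smul d2
  refine ⟨_, d3, fun h k => ?_⟩
  have c1 : Continuous fun x : E => Real.exp (inner ℝ ξ x) • (innerSL ℝ x).smulRight (1:ℝ) :=
    cws continuous_const ξ
  have c2 : Continuous fun x : E => Real.exp (inner ℝ ξ x) • (innerSL ℝ x).smulRight x :=
    cws continuous_id ξ
  have e1 : (∫ x in K, Real.exp (inner ℝ ξ x) • (innerSL ℝ x).smulRight (1:ℝ)) h =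
      ZZ K ξ * inner ℝ (bb K ξ) h := by
    rw [ContinuousLinearMap.integral_apply (cint hK c1), ← int_inner hK]
    simp
  have e2 : inner ℝ k ((∫ x in K, Real.exp (inner ℝ ξ x) • (innerSL ℝ x).smulRight x) h) =
      ∫ x in K, Real.exp (inner ℝ ξ x) * (inner ℝ x h * inner ℝ x k) := by
    rw [ContinuousLinearMap.integral_apply (cint hK c2), ← integral_inner]
    · congr 1
      ext x
      simp [inner_smul_right, real_inner_comm]
    · have : Continuous fun x : E => (Real.exp (inner ℝ ξ x) • (innerSL ℝ x).smulRight x) h := by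
        simp only [smul_apply, ContinuousLinearMap.smulRight_apply, innerSL_apply_apply]
        fun_prop
      exact cint hK this
  have e3 : ∫ x in K, Real.exp (inner ℝ ξ x) * (inner ℝ (x - bb K ξ) h * inner ℝ (x - bb K ξ) k) =
      (∫ x in K, Real.exp (inner ℝ ξ x) * (inner ℝ x h * inner ℝ x k)) -
        ZZ K ξ * inner ℝ (bb K ξ) h * inner ℝ (bb K ξ) k := by
    have : ∀ x : E, Real.exp (inner ℝ ξ x) * (inner ℝ (x - bb K ξ) h * inner ℝ (x - bb K ξ) k) =
      Real.exp (inner ℝ ξ x) * (inner ℝ x h * inner ℝ x k)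
       - inner ℝ (bb K ξ) h * (Real.exp (inner ℝ ξ x) * inner ℝ x k)
       - inner ℝ (bb K ξ) k * (Real.exp (inner ℝ ξ x) * inner ℝ x h)
       + inner ℝ (bb K ξ) h * inner ℝ (bb K ξ) k * Real.exp (inner ℝ ξ x) := by
      intro x; rw [inner_sub_left, inner_sub_left]; ring
    simp_rw [this]
    rw [integral_add, integral_sub, integral_sub, integral_const_mul, integral_const_mul, integral_const_mul,
      int_inner hK, int_inner hK]
    · change _ - _ - _ + _ * ZZ K ξ = _
      ring
    all_goals exact cint hK (by fun_prop)
  rw [e3, ← e2]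
  have em : mm K ξ = ZZ K ξ • bb K ξ := by rw [bb, smul_inv_smul₀ hZ.ne']
  simp only [add_apply, smul_apply, ContinuousLinearMap.smulRight_apply,
    inner_add_right, inner_smul_right, e1, Function.comp_apply]
  change _ + _ * inner ℝ k (mm K ξ) = _
  rw [em, inner_smul_right, real_inner_comm k]
  simp only [smul_eq_mul]
  field_simp
  ring

lemma bb_mem (hK : SymBody K) (ξ : E) : bb K ξ ∈ K := by
  have : NeZero ((volume : Measure E).restrict K) := ⟨by
    rw [Ne, Measure.restrict_eq_zero]
    exact (Measure.measure_pos_of_mem_nhds _ hK.nhds).ne'⟩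
  have hi : Integrable (fun x => Real.exp (inner ℝ ξ x)) (volume.restrict K) := cint hK (by fun_prop)
  have := isProbabilityMeasure_tilted hi
  have hae : ∀ᵐ x ∂((volume.restrict K).tilted (fun x => inner ℝ ξ x)), x ∈ K :=
    (tilted_absolutelyContinuous _ _) (ae_restrict_mem hK.cpt.measurableSet)
  have h1 : bb K ξ = ∫ x, x ∂((volume.restrict K).tilted (fun x => inner ℝ ξ x)) := by
    rw [integral_tilted, bb, mm, ← integral_smul]
    congr 1
    ext x
    rw [smul_smul, ZZ, div_eq_inv_mul]
  rw [h1]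
  refine hK.conv.integral_mem hK.cpt.isClosed hae ?_
  obtain ⟨R, hR⟩ := hK.cpt.isBounded.subset_closedBall (0 : E)
  refine Integrable.of_bound (by fun_prop) R ?_
  filter_upwards [hae] with x hx
  simpa using hR hx

lemma cov_pos (hK : SymBody K) (ξ h : E) (hh : h ≠ 0) : 0 < (ZZ K ξ)⁻¹ *
      ∫ x in K, Real.exp (inner ℝ ξ x) * (inner ℝ (x - bb K ξ) h * inner ℝ (x - bb K ξ) h) := by
  refine mul_pos (inv_pos.2 (ZZ_pos hK ξ)) ?_
  have hc : Continuous fun x : E => Real.exp (inner ℝ ξ x) * (inner ℝ (x - bb K ξ) h * inner ℝ (x - bb K ξ) h) := by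
    fun_prop
  rw [setIntegral_pos_iff_support_of_nonneg_ae]
  · set U := Function.support (fun x : E => Real.exp (inner ℝ ξ x) * (inner ℝ (x - bb K ξ) h * inner ℝ (x - bb K ξ) h))
    have hUo : IsOpen U := hc.isOpen_support
    have hio : IsOpen (U ∩ interior K) := hUo.inter isOpen_interior
    refine lt_of_lt_of_le (hio.measure_pos volume ?_) (measure_mono (Set.inter_subset_inter_right _ interior_subset))
    obtain ⟨r, hr, hrK⟩ := Metric.mem_nhds_iff.1 hK.nhds
    have hbi : Metric.ball (0:E) r ⊆ interior K := interior_maximal hrK Metric.isOpen_ball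
    have hn : 0 < ‖h‖ := norm_pos_iff.2 hh
    by_cases h0 : inner ℝ (bb K ξ) h = 0
    · refine ⟨(r / 2 / ‖h‖) • h, ?_, hbi ?_⟩
      · change Real.exp _ * _ ≠ 0
        rw [inner_sub_left, h0, real_inner_smul_left, real_inner_self_eq_norm_sq]
        simp [Real.exp_ne_zero, hr.ne', hh]
      · rw [mem_ball_zero_iff, norm_smul, Real.norm_of_nonneg (by positivity), div_mul_cancel₀ _ hn.ne']
        linarith
    · refine ⟨0, ?_, hbi (Metric.mem_ball_self hr)⟩
      change Real.exp _ * _ ≠ 0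
      simp [Real.exp_ne_zero, h0]
  · exact Filter.Eventually.of_forall fun x => mul_nonneg (Real.exp_pos _).le (mul_self_nonneg _)
  · exact cint hK hc

lemma bb_inj (hK : SymBody K) : Function.Injective (bb K) := by
  intro ξ η hb
  by_contra hne
  have hh : η - ξ ≠ 0 := sub_ne_zero.2 (Ne.symm hne)
  choose B hB hB' using bb_deriv hK
  have hd : ∀ t : ℝ, HasDerivAt (fun t : ℝ => inner ℝ (η - ξ) (bb K (ξ + t • (η - ξ))))
      (inner ℝ (η - ξ) (B (ξ + t • (η - ξ)) (η - ξ))) t := by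
    intro t
    have h1 : HasDerivAt (fun t : ℝ => ξ + t • (η - ξ)) (η - ξ) t := by
      simpa using ((hasDerivAt_id t).smul_const (η - ξ)).const_add ξ
    have h2 := (hB (ξ + t • (η - ξ))).comp_hasDerivAt t h1
    exact (innerSL ℝ (η - ξ)).hasFDerivAt.comp_hasDerivAt t h2
  have hm : StrictMono (fun t : ℝ => inner ℝ (η - ξ) (bb K (ξ + t • (η - ξ)))) := by
    refine strictMono_of_deriv_pos fun t => ?_
    rw [(hd t).deriv, hB']
    exact cov_pos hK _ _ hh
  have := hm (zero_lt_one)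
  simp [hb] at this

end main
end RBM

open MeasureTheory Real Pointwise

namespace RBM

section main
variable {E : Type*} [NormedAddCommGroup E] [InnerProductSpace ℝ E] [FiniteDimensional ℝ E]

lemma diag (B : E →L[ℝ] E) (hs : ∀ h k, inner ℝ k (B h) = inner ℝ h (B k))
    (hp : ∀ h, h ≠ 0 → 0 < inner ℝ h (B h)) {n : ℕ} (hn : Module.finrank ℝ E = n) :
    ∃ (e : OrthonormalBasis (Fin n) ℝ E) (l : Fin n → ℝ), (∀ i, 0 < l i) ∧ B.det = ∏ i, l i ∧
      ∀ i, B (e i) = l i • e i := by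
  have hT : (B : E →ₗ[ℝ] E).IsSymmetric := by
    intro x y
    have := hs x y
    rw [real_inner_comm] at this
    simpa using this
  have hev : ∀ i, B (hT.eigenvectorBasis hn i) = hT.eigenvalues hn i • hT.eigenvectorBasis hn i := by
    intro i
    exact (hT.hasEigenvector_eigenvectorBasis hn i).apply_eq_smul
  refine ⟨hT.eigenvectorBasis hn, hT.eigenvalues hn, fun i => ?_, ?_, hev⟩
  · have hne : hT.eigenvectorBasis hn i ≠ 0 := (hT.eigenvectorBasis hn).orthonormal.ne_zero i
    have := hp _ hne
    rw [hev, inner_smul_right, real_inner_self_eq_norm_sq] at this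
    simpa using this
  · have := hT.det_eq_prod_eigenvalues hn
    simpa using this

lemma diag_map {n : ℕ} (e : OrthonormalBasis (Fin n) ℝ E) (c : Fin n → ℝ) :
    ∃ u : E →ₗ[ℝ] E, LinearMap.det u = ∏ i, c i ∧ ∀ x, ‖u x‖ ^ 2 = ∑ i, c i ^ 2 * inner ℝ x (e i) ^ 2 := by
  refine ⟨Matrix.toLin e.toBasis e.toBasis (Matrix.diagonal c), ?_, fun x => ?_⟩
  · rw [LinearMap.det_toLin, Matrix.det_diagonal]
  · have h : ∀ i, Matrix.toLin e.toBasis e.toBasis (Matrix.diagonal c) (e i) = c i • e i := by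
      intro i
      have := Matrix.toLin_self e.toBasis e.toBasis (Matrix.diagonal c) i
      simp only [OrthonormalBasis.coe_toBasis] at this
      rw [this]
      simp [Matrix.diagonal_apply]
    have hx : Matrix.toLin e.toBasis e.toBasis (Matrix.diagonal c) x = ∑ i, (c i * inner ℝ x (e i)) • e i := by
      conv_lhs => rw [← e.sum_repr x]
      rw [map_sum]
      refine Finset.sum_congr rfl fun i _ => ?_
      rw [map_smul, h, smul_smul, e.repr_apply_apply, real_inner_comm, mul_comm]
    rw [hx, ← e.sum_sq_norm_inner_right]
    refine Finset.sum_congr rfl fun i _ => ?_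
    rw [inner_sum]
    simp only [inner_smul_right, OrthonormalBasis.inner_eq_ite]
    simp [mul_pow]

variable [MeasurableSpace E] [BorelSpace E] {K : Set E}

lemma int_odd (hK : SymBody K) (ξ : E) : ∫ x in K, inner ℝ ξ x = 0 := by
  have hm := hK.cpt.measurableSet
  have h : ∫ x in K, inner ℝ ξ x = - ∫ x in K, inner ℝ ξ x := by
    rw [← integral_neg, ← integral_indicator hm, ← integral_indicator hm, ← integral_neg_eq_self]
    congr 1
    ext x
    by_cases hx : x ∈ K
    · have hx' := hK.symm x hx
      simp [hx, hx']
    · have hx' : -x ∉ K := fun h => hx (by simpa using hK.symm _ h)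
      simp [hx, hx']
  linarith

lemma ZZ_ge (hK : SymBody K) (ξ : E) : (volume K).toReal ≤ ZZ K ξ := by
  have h1 : ∫ x in K, (inner ℝ ξ x + 1) = (volume K).toReal := by
    rw [integral_add (cint hK (by fun_prop)) (cint hK (by fun_prop)), int_odd hK]
    simp [Measure.real]
  rw [← h1, ZZ]
  refine integral_mono (cint hK (by fun_prop)) (cint hK (by fun_prop)) fun x => ?_
  exact Real.add_one_le_exp _

lemma exists_tilt (hK : SymBody K) (hn : 0 < Module.finrank ℝ E) : ∃ ξ : E, ∃ B : E →L[ℝ] E,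
    (∀ x ∈ K, inner ℝ ξ x ≤ (Module.finrank ℝ E : ℝ)) ∧
    (∀ h k : E, inner ℝ k (B h) = (ZZ K ξ)⁻¹ *
      ∫ x in K, Real.exp (inner ℝ ξ x) * (inner ℝ (x - bb K ξ) h * inner ℝ (x - bb K ξ) k)) ∧
    |B.det| ≤ 3 ^ (Module.finrank ℝ E) * (volume K).toReal ^ 2 := by
  set n := Module.finrank ℝ E with hnd
  have hP := hK.polar
  choose B hB hB' using bb_deriv hK
  set S : Set E := (n:ℝ) • pol K with hS
  have hn' : (0:ℝ) < n := by exact_mod_cast hn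
  have hSc : IsCompact S := hP.cpt.smul _
  have hBm : Measurable fun ξ => ENNReal.ofReal |(B ξ).det| := by
    have : B = fderiv ℝ (bb K) := by ext1 ξ; exact (hB ξ).fderiv.symm
    rw [this]
    have h1 := ContinuousLinearMap.continuous_det.measurable.comp (measurable_fderiv ℝ (bb K))
    exact (measurable_norm.comp h1).ennreal_ofReal
  have hvS : volume S = ENNReal.ofReal ((n:ℝ) ^ n) * volume (pol K) := by
    rw [hS, Measure.addHaar_smul, abs_of_nonneg (by positivity)]
  have hPpos : 0 < volume (pol K) := Measure.measure_pos_of_mem_nhds _ hP.nhds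
  have hVpos : 0 < volume K := Measure.measure_pos_of_mem_nhds _ hK.nhds
  have hPfin : volume (pol K) ≠ ⊤ := hP.cpt.measure_ne_top
  have hVfin : volume K ≠ ⊤ := hK.cpt.measure_ne_top
  have hS0 : volume S ≠ 0 := by
    rw [hvS]
    exact mul_ne_zero (by simp) hPpos.ne'
  have h1 := measure_le_setLAverage_pos hS0 hSc.measure_ne_top (f := fun ξ => ENNReal.ofReal |(B ξ).det|)
    hBm.aemeasurable
  obtain ⟨ξ, hξS, hξ⟩ := nonempty_of_measure_ne_zero h1.ne'
  refine ⟨ξ, B ξ, ?_, hB' ξ, ?_⟩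
  · intro x hx
    obtain ⟨y, hy, rfl⟩ := hξS
    simp only [real_inner_smul_left]
    have := hy x hx
    nlinarith
  · have h2 : ∫⁻ ξ in S, ENNReal.ofReal |(B ξ).det| ≤ volume K := by
      rw [lintegral_abs_det_fderiv_eq_addHaar_image volume hSc.measurableSet
        (fun ξ _ => (hB ξ).hasFDerivWithinAt) (bb_inj hK).injOn]
      exact measure_mono (by rintro _ ⟨η, _, rfl⟩; exact bb_mem hK η)
    rw [setLAverage_eq, ENNReal.le_div_iff_mul_le (Or.inl hS0) (Or.inl hSc.measure_ne_top), hvS] at hξ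
    have h3 := ENNReal.toReal_mono hVfin (hξ.trans h2)
    rw [ENNReal.toReal_mul, ENNReal.toReal_mul, ENNReal.toReal_ofReal (abs_nonneg _),
      ENNReal.toReal_ofReal (by positivity)] at h3
    have h4 := ENNReal.toReal_mono (by finiteness) (bourgain_milman hK)
    rw [ENNReal.toReal_mul, ENNReal.toReal_mul, ENNReal.toReal_ofReal (by positivity),
      ENNReal.toReal_ofReal (by positivity)] at h4
    rw [← hnd] at h4
    set V := (volume K).toReal
    set P := (volume (pol K)).toReal
    set D := |(B ξ).det|
    have hD : 0 ≤ D := abs_nonneg _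
    have hV : 0 < V := ENNReal.toReal_pos hVpos.ne' hVfin
    have hPp : 0 < P := ENNReal.toReal_pos hPpos.ne' hPfin
    have hfac : (n.factorial : ℝ) ≤ (n:ℝ) ^ n := by exact_mod_cast Nat.factorial_le_pow n
    have h5 : D * π ^ n ≤ 8 ^ n * V ^ 2 := by
      calc D * π ^ n ≤ D * (8 ^ n * n.factorial * (V * P)) := by gcongr
        _ ≤ D * (8 ^ n * (n:ℝ) ^ n * (V * P)) := by gcongr
        _ = 8 ^ n * V * (D * ((n:ℝ) ^ n * P)) := by ring
        _ ≤ 8 ^ n * V * V := by gcongr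
        _ = _ := by ring
    have h6 : (8:ℝ) ^ n ≤ 3 ^ n * π ^ n := by
      rw [← mul_pow]
      gcongr
      linarith [Real.pi_gt_three]
    have h7 : D * π ^ n ≤ (3 ^ n * V ^ 2) * π ^ n := by
      calc _ ≤ 8 ^ n * V ^ 2 := h5
        _ ≤ (3 ^ n * π ^ n) * V ^ 2 := by gcongr
        _ = _ := by ring
    exact le_of_mul_le_mul_right h7 (by positivity)

theorem klartag (hK : SymBody K) (hn : 0 < Module.finrank ℝ E) :
    ∃ (u : E →ₗ[ℝ] E) (L : Set E), LinearMap.det u = 1 ∧ IsCompact L ∧ Convex ℝ L ∧ (∀ x ∈ L, -x ∈ L) ∧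
      L ⊆ K ∧ volume K ≤ ENNReal.ofReal (12 ^ (Module.finrank ℝ E)) * volume L ∧
      ∀ x ∈ L, ‖u x‖ ^ 2 ≤ 6 * (Module.finrank ℝ E) *
        ((volume K).toReal ^ ((1:ℝ) / Module.finrank ℝ E)) ^ 2 := by
  obtain ⟨ξ, B, hξ, hB, hD⟩ := exists_tilt hK hn
  set n := Module.finrank ℝ E with hnd
  have hn' : (0:ℝ) < n := by exact_mod_cast hn
  set b := bb K ξ with hb
  have hZ := ZZ_pos hK ξ
  obtain ⟨e, l, hl, hdet, hBe⟩ := diag B (fun h k => by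
      rw [hB, hB]; congr 2; ext x; ring) (fun h hh => by rw [hB]; exact cov_pos hK ξ h hh) hnd.symm
  set D := ∏ i, l i with hDd
  have hDpos : 0 < D := Finset.prod_pos fun i _ => hl i
  rw [hdet, abs_of_pos hDpos] at hD
  set s := D ^ ((1:ℝ) / (2 * n)) with hs
  have hspos : 0 < s := Real.rpow_pos_of_pos hDpos _
  have hs2n : s ^ n = Real.sqrt D := by
    rw [hs, ← Real.rpow_natCast, ← Real.rpow_mul hDpos.le, Real.sqrt_eq_rpow]
    congr 1
    field_simp
  obtain ⟨u, hudet, hu⟩ := diag_map e (fun i => s / Real.sqrt (l i))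
  have hudet1 : LinearMap.det u = 1 := by
    rw [hudet, Finset.prod_div_distrib, Finset.prod_const, Finset.card_univ, Fintype.card_fin, hs2n,
      ← Real.sqrt_prod _ (fun i _ => (hl i).le), ← hDd]
    exact div_self (Real.sqrt_pos.2 hDpos).ne'
  have huc : Continuous u := u.continuous_of_finiteDimensional
  set q := n * s ^ 2 with hq
  have hqpos : 0 < q := by positivity
  -- second moment
  have hmom : ∫ x in K, Real.exp (inner ℝ ξ x) * ‖u (x - b)‖ ^ 2 = ZZ K ξ * q := by
    have h1 : ∀ x, Real.exp (inner ℝ ξ x) * ‖u (x - b)‖ ^ 2 = ∑ i, (s ^ 2 / l i) *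
        (Real.exp (inner ℝ ξ x) * (inner ℝ (x - b) (e i) * inner ℝ (x - b) (e i))) := by
      intro x
      rw [hu, Finset.mul_sum]
      refine Finset.sum_congr rfl fun i _ => ?_
      rw [div_pow, Real.sq_sqrt (hl i).le]; ring
    simp_rw [h1]
    rw [integral_finsetSum _ (fun i _ => cint hK (by fun_prop))]
    have h2 : ∀ i, ∫ x in K, (s ^ 2 / l i) *
        (Real.exp (inner ℝ ξ x) * (inner ℝ (x - b) (e i) * inner ℝ (x - b) (e i))) = ZZ K ξ * s ^ 2 := by
      intro i
      have h3 := hB (e i) (e i)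
      rw [hBe, inner_smul_right, real_inner_self_eq_norm_sq, e.norm_eq_one, one_pow, mul_one,
        eq_inv_mul_iff_mul_eq₀ hZ.ne'] at h3
      rw [integral_const_mul, ← h3]
      have := (hl i).ne'
      field_simp
    simp_rw [h2]
    rw [Finset.sum_const, Finset.card_univ, Fintype.card_fin, nsmul_eq_mul, hq]; ring
  -- the good set
  set G := K ∩ {x | ‖u (x - b)‖ ^ 2 ≤ 2 * q} with hG
  have hcl : IsClosed {x : E | ‖u (x - b)‖ ^ 2 ≤ 2 * q} := isClosed_le (by fun_prop) continuous_const
  have hGc : IsCompact G := hK.cpt.inter_right hcl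
  have hGm := hGc.measurableSet
  have hKm := hK.cpt.measurableSet
  have hwi : IntegrableOn (fun x => Real.exp (inner ℝ ξ x)) K := cint hK (by fun_prop)
  have hwi2 : IntegrableOn (fun x => Real.exp (inner ℝ ξ x) * ‖u (x - b)‖ ^ 2) K := cint hK (by fun_prop)
  have hsplit : (∫ x in G, Real.exp (inner ℝ ξ x)) + ∫ x in K \ G, Real.exp (inner ℝ ξ x) = ZZ K ξ := by
    rw [ZZ, ← setIntegral_union Set.disjoint_sdiff_right (hKm.diff hGm)
      (hwi.mono_set Set.inter_subset_left) (hwi.mono_set Set.sdiff_subset)]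
    congr 2
    exact Set.union_sdiff_cancel Set.inter_subset_left
  have hbad : 2 * q * ∫ x in K \ G, Real.exp (inner ℝ ξ x) ≤ ZZ K ξ * q := by
    rw [← hmom, ← integral_const_mul]
    calc _ ≤ ∫ x in K \ G, Real.exp (inner ℝ ξ x) * ‖u (x - b)‖ ^ 2 := by
          refine setIntegral_mono_on ((hwi.mono_set Set.sdiff_subset).const_mul _)
            (hwi2.mono_set Set.sdiff_subset) (hKm.diff hGm) fun x hx => ?_
          have : 2 * q < ‖u (x - b)‖ ^ 2 := by
            by_contra hc
            exact hx.2 ⟨hx.1, not_lt.1 hc⟩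
          rw [mul_comm]
          gcongr
      _ ≤ _ := by
          refine setIntegral_mono_set hwi2 (Filter.Eventually.of_forall fun x => ?_) Set.sdiff_subset.eventuallyLE
          change 0 ≤ Real.exp (inner ℝ ξ x) * ‖u (x - b)‖ ^ 2
          positivity
  have hbad2 : ∫ x in K \ G, Real.exp (inner ℝ ξ x) ≤ ZZ K ξ / 2 := by
    have : q * (∫ x in K \ G, Real.exp (inner ℝ ξ x)) ≤ q * (ZZ K ξ / 2) := by linarith
    exact le_of_mul_le_mul_left this hqpos
  have hgood : ∫ x in G, Real.exp (inner ℝ ξ x) ≤ Real.exp n * (volume G).toReal := by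
    calc _ ≤ ∫ x in G, Real.exp n := by
          refine setIntegral_mono_on (hwi.mono_set Set.inter_subset_left)
            (integrableOn_const hGc.measure_ne_top) hGm fun x hx => ?_
          exact Real.exp_le_exp.2 (hξ x hx.1)
      _ = _ := by simp [Measure.real, mul_comm]
  have hVG : (volume K).toReal ≤ 2 * Real.exp n * (volume G).toReal := by
    have := ZZ_ge hK ξ
    linarith
  have hVpos : 0 < volume K := Measure.measure_pos_of_mem_nhds _ hK.nhds
  have hVfin : volume K ≠ ⊤ := hK.cpt.measure_ne_top
  have hV : 0 < (volume K).toReal := ENNReal.toReal_pos hVpos.ne' hVfin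
  have hGpos : 0 < (volume G).toReal := by
    by_contra hc
    have : (volume G).toReal = 0 := le_antisymm (not_lt.1 hc) ENNReal.toReal_nonneg
    rw [this] at hVG; linarith
  have hGne : G.Nonempty := by
    by_contra hc
    rw [Set.not_nonempty_iff_eq_empty] at hc
    rw [hc] at hGpos; simp at hGpos
  obtain ⟨p, hp⟩ := hGne
  set L := K ∩ {x | ‖u x‖ ^ 2 ≤ 2 * q} with hL
  have hsub : (1/2 : ℝ) • ((-p) +ᵥ G) ⊆ L := by
    rintro _ ⟨_, ⟨x, hx, rfl⟩, rfl⟩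
    have e1 : (1/2 : ℝ) • (-p +ᵥ x) = (1/2 : ℝ) • x + (1/2 : ℝ) • (-p) := by
      rw [vadd_eq_add, smul_add, add_comm]
    refine ⟨?_, ?_⟩
    · change (1/2 : ℝ) • (-p +ᵥ x) ∈ K
      rw [e1]
      exact hK.conv hx.1 (hK.symm p hp.1) (by norm_num) (by norm_num) (by norm_num)
    · change ‖u ((1/2 : ℝ) • (-p +ᵥ x))‖ ^ 2 ≤ 2 * q
      have e2 : u ((1/2 : ℝ) • (-p +ᵥ x)) = (1/2 : ℝ) • (u (x - b) - u (p - b)) := by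
        rw [← map_sub, ← map_smul, vadd_eq_add]
        congr 2
        abel
      have h1 : ‖u (x - b)‖ ^ 2 ≤ 2 * q := hx.2
      have h2 : ‖u (p - b)‖ ^ 2 ≤ 2 * q := hp.2
      rw [e2, norm_smul, mul_pow]
      have h3 := parallelogram_law_with_norm ℝ (u (x - b)) (u (p - b))
      have h4 : ‖(1/2 : ℝ)‖ ^ 2 = 1/4 := by rw [Real.norm_of_nonneg (by norm_num)]; norm_num
      rw [h4]
      nlinarith [sq_nonneg ‖u (x - b) + u (p - b)‖]
  have hLc : IsCompact L := hK.cpt.inter_right (isClosed_le (by fun_prop) continuous_const)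
  refine ⟨u, L, hudet1, hLc, ?_, ?_, Set.inter_subset_left, ?_, ?_⟩
  · refine hK.conv.inter ?_
    have h1 : {x : E | ‖u x‖ ^ 2 ≤ 2 * q} = u ⁻¹' (Metric.closedBall 0 (Real.sqrt (2 * q))) := by
      ext x
      simp only [Set.mem_ofPred_eq, Set.mem_preimage, mem_closedBall_zero_iff]
      rw [Real.le_sqrt (norm_nonneg _) (by positivity)]
    rw [h1]
    exact (convex_closedBall _ _).linear_preimage u
  · rintro x ⟨hx, hx'⟩
    refine ⟨hK.symm x hx, ?_⟩
    change ‖u (-x)‖ ^ 2 ≤ 2 * q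
    rw [map_neg, norm_neg]; exact hx'
  · have h1 : volume ((1/2 : ℝ) • ((-p) +ᵥ G)) ≤ volume L := measure_mono hsub
    rw [Measure.addHaar_smul, measure_vadd, abs_of_pos (by positivity), ← hnd] at h1
    have h2 := ENNReal.toReal_mono hLc.measure_ne_top h1
    rw [ENNReal.toReal_mul, ENNReal.toReal_ofReal (by positivity)] at h2
    have he : Real.exp n ≤ 3 ^ n := by
      rw [← Real.exp_one_pow]
      gcongr
      linarith [Real.exp_one_lt_d9]
    have h2n : (2:ℝ) ≤ 2 ^ n := by
      calc (2:ℝ) = 2 ^ 1 := by norm_num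
        _ ≤ 2 ^ n := by gcongr; norm_num; omega
    have h3 : (volume G).toReal ≤ 2 ^ n * (volume L).toReal := by
      calc (volume G).toReal = 2 ^ n * ((1/2) ^ n * (volume G).toReal) := by
            rw [← mul_assoc, ← mul_pow]; norm_num
        _ ≤ _ := by gcongr
    have h4 : (volume K).toReal ≤ 12 ^ n * (volume L).toReal := by
      calc _ ≤ 2 * Real.exp n * (volume G).toReal := hVG
        _ ≤ 2 ^ n * 3 ^ n * (2 ^ n * (volume L).toReal) := by gcongr
        _ = 12 ^ n * (volume L).toReal := by
          rw [← mul_assoc, ← mul_pow, ← mul_pow]; norm_num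
    rw [← ENNReal.toReal_le_toReal hVfin (ENNReal.mul_ne_top (by simp) hLc.measure_ne_top), ENNReal.toReal_mul,
      ENNReal.toReal_ofReal (by positivity)]
    exact h4
  · intro x hx
    have h1 : ‖u x‖ ^ 2 ≤ 2 * q := hx.2
    have h2 : s ^ 2 ≤ 3 * ((volume K).toReal ^ ((1:ℝ) / n)) ^ 2 := by
      have e1 : s ^ 2 = D ^ ((1:ℝ) / n) := by
        rw [hs, ← Real.rpow_natCast, ← Real.rpow_mul hDpos.le]
        congr 1
        push_cast; field_simp
      rw [e1]
      calc D ^ ((1:ℝ) / n) ≤ (3 ^ n * (volume K).toReal ^ 2) ^ ((1:ℝ) / n) := by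
            gcongr
        _ = _ := by
          rw [Real.mul_rpow (by positivity) (by positivity), one_div, Real.pow_rpow_inv_natCast (by norm_num) hn.ne',
            ← Real.rpow_natCast, ← Real.rpow_mul hV.le, ← Real.rpow_natCast, ← Real.rpow_mul hV.le, mul_comm ((2:ℕ):ℝ)]
    calc _ ≤ 2 * q := h1
      _ = 2 * n * s ^ 2 := by rw [hq]; ring
      _ ≤ 2 * n * (3 * ((volume K).toReal ^ ((1:ℝ) / n)) ^ 2) := by gcongr
      _ = _ := by ring

end main
end RBM

open MeasureTheory Real Pointwise

namespace RBM

section fin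
variable {E : Type*} [NormedAddCommGroup E] [InnerProductSpace ℝ E] [FiniteDimensional ℝ E]
variable [MeasurableSpace E] [BorelSpace E]

lemma symmetrize {A : Set E} (hA : IsCompact A) (hc : Convex ℝ A) (hi : (interior A).Nonempty) :
    ∃ (x : E) (K : Set E), SymBody K ∧ (∀ v ∈ K, x + v ∈ A) ∧
      volume A ≤ ENNReal.ofReal (2 ^ Module.finrank ℝ E) * volume K ∧ volume K ≤ volume A := by
  classical
  set n := Module.finrank ℝ E with hn
  have hApos : volume A ≠ 0 := (Measure.measure_pos_of_nonempty_interior volume hi).ne'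
  have hAfin : volume A ≠ ⊤ := hA.measure_lt_top.ne
  let Kx : E → Set E := fun x => {v | x + v ∈ A ∧ x - v ∈ A}
  have hclosed : ∀ x, IsClosed (Kx x) := fun x =>
    (hA.isClosed.preimage (by fun_prop : Continuous fun v : E => x + v)).inter
      (hA.isClosed.preimage (by fun_prop : Continuous fun v : E => x - v))
  have hsubA : ∀ x, Kx x ⊆ (fun y => -x + y) '' A := by
    rintro x v ⟨h1, _⟩
    exact ⟨x + v, h1, by simp⟩
  have hvle : ∀ x, volume (Kx x) ≤ volume A := fun x =>
    (measure_mono (hsubA x)).trans (by rw [Set.image_add_left, measure_preimage_add])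
  have hintg : ∫⁻ x, volume (Kx x) = ENNReal.ofReal ((1/2) ^ n) * (volume A * volume A) := by
    have hF : Measurable (A.indicator (1 : E → ENNReal)) :=
      measurable_one.indicator hA.measurableSet
    have h := fub (A.indicator (1 : E → ENNReal)) (A.indicator 1) hF hF
    rw [lintegral_indicator_one hA.measurableSet] at h
    rw [← h, Measure.volume_eq_prod, lintegral_prod]
    · refine lintegral_congr fun x => ?_
      rw [← lintegral_indicator_one (hclosed x).measurableSet]
      refine lintegral_congr fun v => ?_
      by_cases h1 : x + v ∈ A <;> by_cases h2 : x - v ∈ A <;> simp [Set.indicator, Kx, h1, h2]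
    · exact ((hF.comp (measurable_fst.add measurable_snd)).mul
        (hF.comp (measurable_fst.sub measurable_snd))).aemeasurable
  have hint2 : ∫⁻ x in A, volume (Kx x) = ENNReal.ofReal ((1/2) ^ n) * (volume A * volume A) := by
    rw [← hintg, ← lintegral_indicator hA.measurableSet]
    refine lintegral_congr fun x => ?_
    by_cases hx : x ∈ A
    · simp [hx]
    · have : Kx x = ∅ := by
        rw [Set.eq_empty_iff_forall_notMem]
        rintro v ⟨h1, h2⟩
        apply hx
        have := hc h1 h2 (by norm_num : (0:ℝ) ≤ 1/2) (by norm_num : (0:ℝ) ≤ 1/2) (by norm_num)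
        convert this using 1
        module
      simp [hx, this]
  obtain ⟨x, hx, hav⟩ := exists_setLAverage_le (f := fun x => volume (Kx x)) hApos
    hA.measurableSet.nullMeasurableSet
    (by rw [hint2]; exact ENNReal.mul_ne_top ENNReal.ofReal_ne_top (ENNReal.mul_ne_top hAfin hAfin))
  rw [setLAverage_eq, hint2, ← mul_assoc, ENNReal.mul_div_cancel_right hApos hAfin] at hav
  have hvol : volume A ≤ ENNReal.ofReal (2 ^ n) * volume (Kx x) := by
    calc volume A = ENNReal.ofReal (2 ^ n) * (ENNReal.ofReal ((1/2) ^ n) * volume A) := by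
          rw [← mul_assoc, ← ENNReal.ofReal_mul (by positivity), ← mul_pow]; norm_num
      _ ≤ _ := by gcongr
  have hconv : Convex ℝ (Kx x) := by
    rintro v ⟨h1, h2⟩ w ⟨h3, h4⟩ a b ha hb hab
    constructor
    · convert hc h1 h3 ha hb hab using 1
      rw [smul_add, smul_add, add_add_add_comm, ← add_smul, hab, one_smul]
    · convert hc h2 h4 ha hb hab using 1
      rw [smul_sub, smul_sub, sub_add_sub_comm, ← add_smul, hab, one_smul]
  have hsymm : ∀ v ∈ Kx x, -v ∈ Kx x := by
    rintro v ⟨h1, h2⟩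
    exact ⟨by rwa [← sub_eq_add_neg], by rwa [sub_neg_eq_add]⟩
  have hKpos : volume (Kx x) ≠ 0 := by
    intro h0
    rw [h0, mul_zero] at hvol
    exact hApos (le_antisymm hvol zero_le)
  have hint0 : (interior (Kx x)).Nonempty := by
    by_contra hne
    rw [Set.not_nonempty_iff_eq_empty] at hne
    have := hconv.addHaar_frontier volume
    rw [(hclosed x).frontier_eq, hne, Set.diff_empty] at this
    exact hKpos this
  obtain ⟨w, hw⟩ := hint0
  have h0 : (0:E) ∈ interior (Kx x) := by
    have := hconv.add_smul_sub_mem_interior (hsymm w (interior_subset hw)) hw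
      (t := 1/2) ⟨by norm_num, by norm_num⟩
    convert this using 1
    module
  refine ⟨x, Kx x, ⟨?_, hconv, mem_interior_iff_mem_nhds.1 h0, hsymm⟩, fun v hv => hv.1, hvol, hvle x⟩
  refine IsCompact.of_isClosed_subset (hA.image (by fun_prop : Continuous fun y : E => -x + y))
    (hclosed x) (hsubA x)

lemma ruzsa {M A D : Set E} (hM : IsCompact M) (hA : IsCompact A) (hD : IsCompact D)
    (hs : ∀ x ∈ M, -x ∈ M) :
    volume M * volume (A + D) ≤ volume (A + M) * volume (M + D) := by
  classical
  have hP : MeasurableSet (A + M) := (hA.add hM).measurableSet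
  have hQ : MeasurableSet (M + D) := (hM.add hD).measurableSet
  have hAD : MeasurableSet (A + D) := (hA.add hD).measurableSet
  set P := A + M
  set Q := M + D
  let F : E → E → ENNReal := fun x y => P.indicator 1 y * Q.indicator 1 (x - y)
  have h1P : Measurable (P.indicator (1 : E → ENNReal)) := measurable_one.indicator hP
  have h1Q : Measurable (Q.indicator (1 : E → ENNReal)) := measurable_one.indicator hQ
  have hintg : ∫⁻ x, ∫⁻ y, F x y = volume P * volume Q := by
    rw [lintegral_lintegral_swap]
    · have : ∀ y, ∫⁻ x, F x y = P.indicator 1 y * volume Q := by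
        intro y
        simp only [F]
        rw [lintegral_const_mul _ (by exact h1Q.comp (measurable_id.sub_const y) : Measurable fun x => Q.indicator (1 : E → ENNReal) (x - y)),
          lintegral_sub_right_eq_self (μ := volume) (Q.indicator (1 : E → ENNReal)) y,
          lintegral_indicator_one hQ]
      simp_rw [this]
      rw [lintegral_mul_const _ h1P, lintegral_indicator_one hP]
    · exact ((h1P.comp measurable_snd).mul
        (h1Q.comp (measurable_fst.sub measurable_snd))).aemeasurable
  rw [← hintg, mul_comm, ← lintegral_indicator_one hAD, ← lintegral_mul_const _ (measurable_one.indicator hAD)]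
  refine lintegral_mono fun x => ?_
  by_cases hx : x ∈ A + D
  · obtain ⟨a, ha, d, hd, rfl⟩ := hx
    have hmem : a + d ∈ A + D := ⟨a, ha, d, hd, rfl⟩
    simp only [Set.indicator_of_mem hmem, Pi.one_apply, one_mul]
    have : volume M = volume ((fun y => a + y) '' M) := by
      rw [Set.image_add_left, measure_preimage_add]
    rw [this, ← lintegral_indicator_one (hM.image (by fun_prop)).measurableSet]
    refine lintegral_mono fun y => ?_
    by_cases hy : y ∈ (fun y => a + y) '' M
    · obtain ⟨m, hm, rfl⟩ := hy
      have h1 : a + m ∈ P := ⟨a, ha, m, hm, rfl⟩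
      have h2 : a + d - (a + m) ∈ Q := ⟨-m, hs m hm, d, hd, by simp; abel⟩
      simp only [F]
      rw [Set.indicator_of_mem h1, Set.indicator_of_mem h2, Set.indicator_of_mem (Set.mem_image_of_mem _ hm)]
      simp
    · rw [Set.indicator_of_notMem hy]; exact zero_le
  · simp [hx]

lemma ball_vol : volume (Metric.closedBall (0:E) (√(Module.finrank ℝ E)))
    ≤ ENNReal.ofReal (6 ^ Module.finrank ℝ E) := by
  set n := Module.finrank ℝ E with hn
  have hG := GaussianFourier.integral_rexp_neg_mul_sq_norm (V := E) (b := 1) one_pos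
  have hpos : (0:ℝ) < (π / 1) ^ ((Module.finrank ℝ E : ℝ) / 2) := by positivity
  have hI : Integrable (fun v : E => rexp (-1 * ‖v‖ ^ 2)) := by
    by_contra h
    rw [integral_undef h] at hG
    exact hpos.ne hG
  have h1 : ENNReal.ofReal (rexp (-n)) * volume (Metric.closedBall (0:E) (√n)) ≤
      ∫⁻ v : E, ENNReal.ofReal (rexp (-1 * ‖v‖ ^ 2)) := by
    rw [← setLIntegral_const]
    refine le_trans ?_ (setLIntegral_le_lintegral (Metric.closedBall (0:E) (√n)) _)
    refine setLIntegral_mono' Metric.isClosed_closedBall.measurableSet fun v hv => ?_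
    apply ENNReal.ofReal_le_ofReal
    apply Real.exp_le_exp.2
    rw [mem_closedBall_zero_iff] at hv
    have : ‖v‖ ^ 2 ≤ n := by
      calc ‖v‖ ^ 2 ≤ (√(n:ℝ)) ^ 2 := by gcongr
        _ = (n:ℝ) := Real.sq_sqrt (by positivity)
    linarith
  rw [← ofReal_integral_eq_lintegral_ofReal hI (Filter.Eventually.of_forall fun v => by positivity), hG] at h1
  have h2 : volume (Metric.closedBall (0:E) (√n)) = ENNReal.ofReal (rexp n) *
      (ENNReal.ofReal (rexp (-n)) * volume (Metric.closedBall (0:E) (√n))) := by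
    rw [← mul_assoc, ← ENNReal.ofReal_mul (by positivity), ← Real.exp_add]; simp
  rw [h2]
  refine (mul_le_mul_right h1 _).trans ?_
  rw [← ENNReal.ofReal_mul (by positivity)]
  apply ENNReal.ofReal_le_ofReal
  have e1 : rexp n = rexp 1 ^ n := by rw [← Real.exp_nat_mul]; simp
  have e2 : (π / 1) ^ ((n : ℝ) / 2) = √π ^ n := by
    rw [div_one, Real.sqrt_eq_rpow, ← Real.rpow_natCast, ← Real.rpow_mul pi_pos.le]
    ring_nf
  rw [e1, e2, ← mul_pow]
  have h3 : rexp 1 ≤ 3 := Real.exp_one_lt_three.le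
  have h4 : √π ≤ 2 := by
    rw [Real.sqrt_le_left (by norm_num)]; linarith [Real.pi_le_four]
  gcongr
  nlinarith [Real.exp_pos 1, Real.sqrt_nonneg π]

lemma ball_vol' {ρ : ℝ} (hρ : 0 ≤ ρ) : volume (Metric.closedBall (0:E) (ρ * √(Module.finrank ℝ E)))
    ≤ ENNReal.ofReal ((6 * ρ) ^ Module.finrank ℝ E) := by
  have : Metric.closedBall (0:E) (ρ * √(Module.finrank ℝ E)) =
      ρ • Metric.closedBall (0:E) (√(Module.finrank ℝ E)) := by
    rw [smul_closedBall _ _ (by positivity)]; simp [abs_of_nonneg hρ]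
  rw [this, Measure.addHaar_smul, abs_of_nonneg (by positivity), mul_comm 6, mul_pow,
    ENNReal.ofReal_mul (by positivity)]
  exact mul_le_mul_right ball_vol _

lemma position {A : Set E} (hA : IsCompact A) (hc : Convex ℝ A) (hi : (interior A).Nonempty)
    (hn : 0 < Module.finrank ℝ E) :
    ∃ (u : E →ₗ[ℝ] E) (M : Set E) (z : E), LinearMap.det u = 1 ∧ IsCompact M ∧
      (∀ x ∈ M, -x ∈ M) ∧ (∀ m ∈ M, z + (2:ℝ) • m ∈ u '' A) ∧
      volume A ≤ ENNReal.ofReal (48 ^ Module.finrank ℝ E) * volume M ∧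
      ∀ m ∈ M, ‖m‖ ≤ 2 * (volume A).toReal ^ ((1:ℝ) / Module.finrank ℝ E) * √(Module.finrank ℝ E) := by
  obtain ⟨x, K, hK, hxK, h1, h2⟩ := symmetrize hA hc hi
  obtain ⟨u, L, hu, hLc, hLconv, hLs, hLK, hvol, hnorm⟩ := klartag hK hn
  set n := Module.finrank ℝ E with hnn
  have huc : Continuous u := u.continuous_of_finiteDimensional
  refine ⟨u, u '' ((1/2 : ℝ) • L), u x, hu, (hLc.smul _).image huc, ?_, ?_, ?_, ?_⟩
  · rintro _ ⟨_, ⟨l, hl, rfl⟩, rfl⟩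
    exact ⟨_, ⟨-l, hLs l hl, rfl⟩, by simp⟩
  · rintro _ ⟨_, ⟨l, hl, rfl⟩, rfl⟩
    refine ⟨x + l, hxK l (hLK hl), ?_⟩
    simp [smul_smul]
  · rw [Measure.addHaar_image_linearMap, hu, Measure.addHaar_smul, ← hnn]
    calc volume A ≤ ENNReal.ofReal (2 ^ n) * (ENNReal.ofReal (12 ^ n) * volume L) := by
          exact h1.trans (mul_le_mul_right hvol _)
      _ = _ := by
        rw [abs_of_nonneg (by positivity : (0:ℝ) ≤ (1/2) ^ n)]
        simp only [abs_one, ENNReal.ofReal_one, one_mul]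
        rw [← mul_assoc, ← mul_assoc, ← ENNReal.ofReal_mul (by positivity),
          ← ENNReal.ofReal_mul (by positivity), ← mul_pow, ← mul_pow]
        norm_num
  · rintro _ ⟨_, ⟨l, hl, rfl⟩, rfl⟩
    have h3 := hnorm l hl
    have h4 : (volume K).toReal ^ ((1:ℝ) / n) ≤ (volume A).toReal ^ ((1:ℝ) / n) := by
      apply Real.rpow_le_rpow (by positivity) _ (by positivity)
      exact ENNReal.toReal_mono hA.measure_lt_top.ne h2
    have h5 : (0:ℝ) ≤ (volume K).toReal ^ ((1:ℝ) / n) := by positivity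
    set a := (volume A).toReal ^ ((1:ℝ) / n)
    set k := (volume K).toReal ^ ((1:ℝ) / n)
    have h6 : k ^ 2 ≤ a ^ 2 := by gcongr
    have hs : (√(n:ℝ)) ^ 2 = n := Real.sq_sqrt (by positivity)
    simp only [map_smul, norm_smul]
    rw [Real.norm_of_nonneg (by norm_num)]
    apply le_of_sq_le_sq _ (by positivity)
    rw [mul_pow, mul_pow, mul_pow, hs]
    have : (6:ℝ) * n * k ^ 2 ≤ 6 * n * a ^ 2 := by gcongr
    nlinarith [mul_nonneg (Nat.cast_nonneg (α := ℝ) n) (sq_nonneg a)]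

lemma sum_vol {A M : Set E} (hc : Convex ℝ A) {z : E}
    (h : ∀ m ∈ M, z + (2:ℝ) • m ∈ A) :
    volume (A + M) ≤ ENNReal.ofReal ((3/2) ^ Module.finrank ℝ E) * volume A := by
  have hsub : A + M ⊆ (fun y => -((1/2:ℝ) • z) + y) '' ((3/2 : ℝ) • A) := by
    rintro _ ⟨a, ha, m, hm, rfl⟩
    refine ⟨a + (1/2:ℝ) • (z + (2:ℝ) • m), ?_, ?_⟩
    · have : (3/2 : ℝ) • A = (1:ℝ) • A + (1/2:ℝ) • A := by
        rw [← hc.add_smul (by norm_num) (by norm_num)]; norm_num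
      rw [this]
      exact ⟨a, by simpa using ha, _, Set.smul_mem_smul_set (h m hm), rfl⟩
    · simp only; module
  refine (measure_mono hsub).trans ?_
  rw [Set.image_add_left, measure_preimage_add, Measure.addHaar_smul, abs_of_nonneg (by positivity)]

lemma main_bound {A₁ A₂ : Set E} (hA₁ : IsCompact A₁) (hc₁ : Convex ℝ A₁)
    (hi₁ : (interior A₁).Nonempty) (hA₂ : IsCompact A₂) (hc₂ : Convex ℝ A₂)
    (hi₂ : (interior A₂).Nonempty) (hn : 0 < Module.finrank ℝ E) :
    ∃ u₁ u₂ : E →ₗ[ℝ] E, LinearMap.det u₁ = 1 ∧ LinearMap.det u₂ = 1 ∧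
      volume (u₁ '' A₁ + u₂ '' A₂) ≤ ENNReal.ofReal ((62208 * (
        (volume A₁).toReal ^ ((1:ℝ) / Module.finrank ℝ E) +
        (volume A₂).toReal ^ ((1:ℝ) / Module.finrank ℝ E))) ^ Module.finrank ℝ E) := by
  obtain ⟨u₁, M₁, z₁, hu₁, hM₁, hs₁, hz₁, hv₁, hb₁⟩ := position hA₁ hc₁ hi₁ hn
  obtain ⟨u₂, M₂, z₂, hu₂, hM₂, hs₂, hz₂, hv₂, hb₂⟩ := position hA₂ hc₂ hi₂ hn
  refine ⟨u₁, u₂, hu₁, hu₂, ?_⟩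
  set n := Module.finrank ℝ E with hnn
  set a₁ := (volume A₁).toReal ^ ((1:ℝ) / n)
  set a₂ := (volume A₂).toReal ^ ((1:ℝ) / n)
  have ha₁ : 0 ≤ a₁ := by positivity
  have ha₂ : 0 ≤ a₂ := by positivity
  have hB₁ : IsCompact (u₁ '' A₁) := hA₁.image u₁.continuous_of_finiteDimensional
  have hB₂ : IsCompact (u₂ '' A₂) := hA₂.image u₂.continuous_of_finiteDimensional
  have hV₁ : volume (u₁ '' A₁) = volume A₁ := by
    rw [Measure.addHaar_image_linearMap, hu₁]; simp
  have hV₂ : volume (u₂ '' A₂) = volume A₂ := by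
    rw [Measure.addHaar_image_linearMap, hu₂]; simp
  have s₁ := sum_vol (hc₁.linear_image u₁) hz₁
  have s₂ := sum_vol (hc₂.linear_image u₂) hz₂
  rw [hV₁] at s₁
  rw [hV₂, add_comm] at s₂
  rw [← hnn] at s₁ s₂
  have r₁ := ruzsa hM₁ hB₁ hB₂ hs₁
  have r₂ := ruzsa hM₂ hM₁ hB₂ hs₂
  have hball : volume (M₁ + M₂) ≤ ENNReal.ofReal ((6 * (2 * (a₁ + a₂))) ^ n) := by
    refine (measure_mono ?_).trans (ball_vol' (E := E) (ρ := 2 * (a₁ + a₂)) (by positivity))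
    rintro _ ⟨m₁, h₁, m₂, h₂, rfl⟩
    rw [mem_closedBall_zero_iff]
    refine (norm_add_le _ _).trans ?_
    have := hb₁ m₁ h₁
    have := hb₂ m₂ h₂
    simp only [← hnn] at *
    linarith
  set S := volume (u₁ '' A₁ + u₂ '' A₂)
  set T := volume (M₁ + M₂)
  set c := ENNReal.ofReal ((3/2) ^ n)
  set d := ENNReal.ofReal (48 ^ n)
  have f₁ : volume A₁ ≠ ⊤ := hA₁.measure_lt_top.ne
  have f₂ : volume A₂ ≠ ⊤ := hA₂.measure_lt_top.ne
  have p₁ : volume A₁ ≠ 0 := (Measure.measure_pos_of_nonempty_interior volume hi₁).ne'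
  have p₂ : volume A₂ ≠ 0 := (Measure.measure_pos_of_nonempty_interior volume hi₂).ne'
  have key : (volume A₁ * volume A₂) * S ≤ (volume A₁ * volume A₂) * ((d * c) * (d * c) * T) := by
    calc (volume A₁ * volume A₂) * S ≤ ((d * volume M₁) * (d * volume M₂)) * S := by gcongr
      _ = (d * d) * (volume M₂ * (volume M₁ * S)) := by ring
      _ ≤ (d * d) * (volume M₂ * (c * volume A₁ * volume (M₁ + u₂ '' A₂))) := by
          exact mul_le_mul_right (mul_le_mul_right (r₁.trans (mul_le_mul_left s₁ _)) _) _
      _ = (d * d) * (c * volume A₁) * (volume M₂ * volume (M₁ + u₂ '' A₂)) := by ring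
      _ ≤ (d * d) * (c * volume A₁) * (T * (c * volume A₂)) := by
          exact mul_le_mul_right (r₂.trans (mul_le_mul_right s₂ _)) _
      _ = _ := by ring
  have key2 : S ≤ (d * c) * (d * c) * T :=
    (ENNReal.mul_le_mul_iff_right (mul_ne_zero p₁ p₂) (ENNReal.mul_ne_top f₁ f₂)).1 key
  refine key2.trans ((mul_le_mul_right hball _).trans ?_)
  simp only [c, d]
  rw [← ENNReal.ofReal_mul (by positivity), ← ENNReal.ofReal_mul (by positivity),
    ← ENNReal.ofReal_mul (by positivity), ← mul_pow, ← mul_pow, ← mul_pow]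
  apply ENNReal.ofReal_le_ofReal
  exact pow_le_pow_left₀ (by positivity) (by linarith) n

lemma mp_of_det {u : E →ₗ[ℝ] E} (hu : LinearMap.det u = 1) :
    MeasurePreserving (u.toAffineMap) volume volume := by
  refine ⟨u.continuous_of_finiteDimensional.measurable, ?_⟩
  have := Measure.map_linearMap_addHaar_eq_smul_addHaar (μ := (volume : Measure E)) (f := u)
    (by rw [hu]; norm_num)
  rw [hu] at this
  simpa using this

end fin
end RBM

open MeasureTheory Real Pointwise

/-- Milman's reverse Brunn–Minkowski inequality: there is a universal constant
`C` such that for all convex bodies `A₁, A₂ ⊂ ℝⁿ` there exist affine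
volume-preserving maps `u₁, u₂` of ℝⁿ with
`|u₁(A₁) + u₂(A₂)|^{1/n} ≤ C (|A₁|^{1/n} + |A₂|^{1/n})`. -/
theorem reverse_brunn_minkowski :
    ∃ C : ℝ, 0 < C ∧
    ∀ (n : ℕ), 1 ≤ n →
    ∀ (A₁ A₂ : Set (EuclideanSpace ℝ (Fin n))),
      IsCompact A₁ → Convex ℝ A₁ → (interior A₁).Nonempty →
      IsCompact A₂ → Convex ℝ A₂ → (interior A₂).Nonempty →
      ∃ (u₁ u₂ : EuclideanSpace ℝ (Fin n) →ᵃ[ℝ] EuclideanSpace ℝ (Fin n)),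
        MeasurePreserving u₁ volume volume ∧
        MeasurePreserving u₂ volume volume ∧
        (volume ((⇑u₁) '' A₁ + (⇑u₂) '' A₂)).toReal ^ ((1 : ℝ) / n)
          ≤ C * ((volume A₁).toReal ^ ((1 : ℝ) / n)
                + (volume A₂).toReal ^ ((1 : ℝ) / n)) := by
  refine ⟨62208, by norm_num, ?_⟩
  intro n hn A₁ A₂ hA₁ hc₁ hi₁ hA₂ hc₂ hi₂
  have hf : Module.finrank ℝ (EuclideanSpace ℝ (Fin n)) = n := finrank_euclideanSpace_fin
  obtain ⟨u₁, u₂, h₁, h₂, hb⟩ := RBM.main_bound hA₁ hc₁ hi₁ hA₂ hc₂ hi₂ (by rw [hf]; omega)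
  rw [hf] at hb
  refine ⟨u₁.toAffineMap, u₂.toAffineMap, RBM.mp_of_det h₁, RBM.mp_of_det h₂, ?_⟩
  set a := (volume A₁).toReal ^ ((1 : ℝ) / n) + (volume A₂).toReal ^ ((1 : ℝ) / n)
  have ha : 0 ≤ a := by positivity
  have h3 := ENNReal.toReal_le_of_le_ofReal (by positivity) hb
  calc (volume ((⇑u₁.toAffineMap) '' A₁ + (⇑u₂.toAffineMap) '' A₂)).toReal ^ ((1 : ℝ) / n)
      ≤ ((62208 * a) ^ n) ^ ((1 : ℝ) / n) :=
        Real.rpow_le_rpow ENNReal.toReal_nonneg h3 (by positivity)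
    _ = 62208 * a := by
        rw [one_div]
        exact Real.pow_rpow_inv_natCast (by positivity) (by omega)
end
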